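/- arXiv:2308.11238 — 3 statements merged into one kernel-verified Lean document; each statement's English description precedes it below -/
import Mathlib

section
/- Let h be a convex distortion function and let c:ℝ²→ℝ be a submodular cost function that is monotone (either increasing in each argument or decreasing in each argument). If X and Y are bounded comonotonic random variables, then for all bounded random variables X', Y' with X' equal in distribution to X and Y' equal in distribution to Y, one has E^h[c(X,Y)] ≤ E^h[c(X',Y')]. (That is, the comonotonic coupling is universally optimal for (c,h).) -/
open MeasureTheory Set ProbabilityTheory

noncomputable section

variable {Ω : Type*} [MeasurableSpace Ω]

/-- An atomless probability measure: every non-null measurable set has a measurable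
subset of strictly smaller positive measure. -/
def AtomlessProb (P : Measure Ω) : Prop :=
  ∀ A : Set Ω, MeasurableSet A → 0 < P A →
    ∃ B ⊆ A, MeasurableSet B ∧ 0 < P B ∧ P B < P A

/-- A distortion function: increasing on `[0,1]` with `h 0 = 0` and `h 1 = 1`. -/
def IsDistortion (h : ℝ → ℝ) : Prop :=
  MonotoneOn h (Icc 0 1) ∧ h 0 = 0 ∧ h 1 = 1

/-- The distorted expectation `E^h[Z]`. -/
def distExp (P : Measure Ω) (h : ℝ → ℝ) (Z : Ω → ℝ) : ℝ :=
  (∫ x in Ioi (0:ℝ), h (P {ω | Z ω > x}).toReal) +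
  (∫ x in Iio (0:ℝ), (h (P {ω | Z ω > x}).toReal - 1))

/-- Bounded measurable real random variable. -/
def IsBddRV (X : Ω → ℝ) : Prop :=
  Measurable X ∧ ∃ M : ℝ, ∀ ω, |X ω| ≤ M

/-- X and Y are comonotonic. -/
def Comonotone (P : Measure Ω) (X Y : Ω → ℝ) : Prop :=
  ∃ f g : ℝ → ℝ, Monotone f ∧ Monotone g ∧
    ∀ᵐ ω ∂P, X ω = f (X ω + Y ω) ∧ Y ω = g (X ω + Y ω)

/-- X and Y are counter-monotonic: X and -Y are comonotonic. -/
def CounterMonotone (P : Measure Ω) (X Y : Ω → ℝ) : Prop :=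
  Comonotone P X (fun ω => -Y ω)

def Submodular (c : ℝ → ℝ → ℝ) : Prop :=
  ∀ x₁ y₁ x₂ y₂ : ℝ,
    c (min x₁ x₂) (min y₁ y₂) + c (max x₁ x₂) (max y₁ y₂) ≤ c x₁ y₁ + c x₂ y₂

def Supermodular (c : ℝ → ℝ → ℝ) : Prop :=
  ∀ x₁ y₁ x₂ y₂ : ℝ,
    c x₁ y₁ + c x₂ y₂ ≤ c (min x₁ x₂) (min y₁ y₂) + c (max x₁ x₂) (max y₁ y₂)

/-- c is monotone: increasing in each argument or decreasing in each argument. -/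
def MonotoneCost (c : ℝ → ℝ → ℝ) : Prop :=
  Monotone (fun q : ℝ × ℝ => c q.1 q.2) ∨ Antitone (fun q : ℝ × ℝ => c q.1 q.2)

/-- A 2-copula. -/
def IsCopula (C : ℝ → ℝ → ℝ) : Prop :=
  (∀ u ∈ Icc (0:ℝ) 1, C u 0 = 0 ∧ C 0 u = 0 ∧ C u 1 = u ∧ C 1 u = u) ∧
  (∀ u₁ u₂ v₁ v₂ : ℝ, u₁ ∈ Icc (0:ℝ) 1 → u₂ ∈ Icc (0:ℝ) 1 →
    v₁ ∈ Icc (0:ℝ) 1 → v₂ ∈ Icc (0:ℝ) 1 → u₁ ≤ u₂ → v₁ ≤ v₂ →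
    0 ≤ C u₂ v₂ - C u₂ v₁ - C u₁ v₂ + C u₁ v₁)

/-- (X, Y) has copula C. -/
def HasCopula (P : Measure Ω) (X Y : Ω → ℝ) (C : ℝ → ℝ → ℝ) : Prop :=
  ∀ x y : ℝ, (P {ω | X ω ≤ x ∧ Y ω ≤ y}).toReal =
    C (P {ω | X ω ≤ x}).toReal (P {ω | Y ω ≤ y}).toReal

/-- C is universally optimal for h with linear cost. -/
def UnivOptimal (P : Measure Ω) (h : ℝ → ℝ) (C : ℝ → ℝ → ℝ) : Prop :=
  ∀ X Y X' Y' : Ω → ℝ, IsBddRV X → IsBddRV Y → IsBddRV X' → IsBddRV Y' →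
    HasCopula P X Y C → IdentDistrib X X' P P → IdentDistrib Y Y' P P →
    distExp P h (fun ω => X ω + Y ω) ≤ distExp P h (fun ω => X' ω + Y' ω)

/-- C is universally maximal for h with linear cost. -/
def UnivMaximal (P : Measure Ω) (h : ℝ → ℝ) (C : ℝ → ℝ → ℝ) : Prop :=
  ∀ X Y X' Y' : Ω → ℝ, IsBddRV X → IsBddRV Y → IsBddRV X' → IsBddRV Y' →
    HasCopula P X Y C → IdentDistrib X X' P P → IdentDistrib Y Y' P P →
    distExp P h (fun ω => X' ω + Y' ω) ≤ distExp P h (fun ω => X ω + Y ω)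

/-- C is universally optimal within a class 𝒞 of copulas for h with linear cost. -/
def UnivOptimalWithin (P : Measure Ω) (h : ℝ → ℝ) (C : ℝ → ℝ → ℝ)
    (𝒞 : Set (ℝ → ℝ → ℝ)) : Prop :=
  ∀ X Y X' Y' : Ω → ℝ, IsBddRV X → IsBddRV Y → IsBddRV X' → IsBddRV Y' →
    HasCopula P X Y C → (∃ C' ∈ 𝒞, HasCopula P X' Y' C') →
    IdentDistrib X X' P P → IdentDistrib Y Y' P P →
    distExp P h (fun ω => X ω + Y ω) ≤ distExp P h (fun ω => X' ω + Y' ω)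

/-- C is universally maximal within a class 𝒞 of copulas for h with linear cost. -/
def UnivMaximalWithin (P : Measure Ω) (h : ℝ → ℝ) (C : ℝ → ℝ → ℝ)
    (𝒞 : Set (ℝ → ℝ → ℝ)) : Prop :=
  ∀ X Y X' Y' : Ω → ℝ, IsBddRV X → IsBddRV Y → IsBddRV X' → IsBddRV Y' →
    HasCopula P X Y C → (∃ C' ∈ 𝒞, HasCopula P X' Y' C') →
    IdentDistrib X X' P P → IdentDistrib Y Y' P P →
    distExp P h (fun ω => X' ω + Y' ω) ≤ distExp P h (fun ω => X ω + Y ω)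

/-- The set 𝒞_p of copulas C with C(1-p,1-p) = 1-p. -/
def copulaSet (p : ℝ) : Set (ℝ → ℝ → ℝ) :=
  {C | IsCopula C ∧ C (1 - p) (1 - p) = 1 - p}

/-- The "first comonotonic, then counter-monotonic" copula C^±_p. -/
def Cpm (p : ℝ) (u v : ℝ) : ℝ :=
  if min u v ≤ 1 - p then min u v else max (u + v - 1) (1 - p)

/-- The "first counter-monotonic, then comonotonic" copula C^∓_p. -/
def Cmp (p : ℝ) (u v : ℝ) : ℝ :=
  if max u v ≤ 1 - p then max (u + v - 1 + p) 0 else min u v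

/-- Inverse S-shaped distortion with inflection point p: continuous, concave on (0,p),
convex on (p,1). -/
def IsISS (h : ℝ → ℝ) (p : ℝ) : Prop :=
  ContinuousOn h (Icc 0 1) ∧ ConcaveOn ℝ (Ioo 0 p) h ∧ ConvexOn ℝ (Ioo p 1) h

/-- Strictly inverse S-shaped distortion with inflection point p. -/
def IsStrictISS (h : ℝ → ℝ) (p : ℝ) : Prop :=
  ContinuousOn h (Icc 0 1) ∧ StrictConcaveOn ℝ (Ioo 0 p) h ∧ StrictConvexOn ℝ (Ioo p 1) h

/-- S-shaped distortion with inflection point p: continuous, convex on (0,p),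
concave on (p,1). -/
def IsSS (h : ℝ → ℝ) (p : ℝ) : Prop :=
  ContinuousOn h (Icc 0 1) ∧ ConvexOn ℝ (Ioo 0 p) h ∧ ConcaveOn ℝ (Ioo p 1) h

/-- Strictly S-shaped distortion with inflection point p. -/
def IsStrictSS (h : ℝ → ℝ) (p : ℝ) : Prop :=
  ContinuousOn h (Icc 0 1) ∧ StrictConvexOn ℝ (Ioo 0 p) h ∧ StrictConcaveOn ℝ (Ioo p 1) h

/-- Left quantile of Z at level t. -/
def leftQuantile (P : Measure Ω) (Z : Ω → ℝ) (t : ℝ) : ℝ :=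
  sInf {x : ℝ | t ≤ (P {ω | Z ω ≤ x}).toReal}

/-- W is (a version of) the upper p-tail transform Z^∨_p of Z: its left-quantile
function is t ↦ Q_{(1-p)+pt}(Z). -/
def IsUpperTail (P : Measure Ω) (p : ℝ) (Z W : Ω → ℝ) : Prop :=
  ∀ t ∈ Ioc (0:ℝ) 1, leftQuantile P W t = leftQuantile P Z ((1 - p) + p * t)

/-- W is (a version of) the lower tail transform Z^∧_p of Z: its left-quantile
function is t ↦ Q_{(1-p)t}(Z). -/
def IsLowerTail (P : Measure Ω) (p : ℝ) (Z W : Ω → ℝ) : Prop :=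
  ∀ t ∈ Ioc (0:ℝ) 1, leftQuantile P W t = leftQuantile P Z ((1 - p) * t)

/-- Expected Shortfall at level p. -/
def ES (P : Measure Ω) (p : ℝ) (Z : Ω → ℝ) : ℝ :=
  (1 / (1 - p)) * ∫ r in p..1, leftQuantile P Z r

theorem IsDistortion.apply_measureReal_mono {P : Measure Ω} [IsProbabilityMeasure P] {h : ℝ → ℝ}
    (hd : IsDistortion h) {A B : Set Ω} (hAB : P A ≤ P B) : h (P.real A) ≤ h (P.real B) :=
  hd.1 ⟨measureReal_nonneg, measureReal_le_one⟩ ⟨measureReal_nonneg, measureReal_le_one⟩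
    (ENNReal.toReal_mono (measure_ne_top _ _) hAB)

theorem IsDistortion.antitone_apply_measureReal {P : Measure Ω} [IsProbabilityMeasure P]
    {h : ℝ → ℝ} (hd : IsDistortion h) (Z : Ω → ℝ) (B : Set Ω) :
    Antitone fun t => h (P.real ({ω | Z ω > t} ∩ B)) := fun _ _ hst =>
  hd.apply_measureReal_mono (measure_mono (inter_subset_inter_left _ fun _ hω => hst.trans_lt hω))

theorem IsDistortion.intervalIntegrable {P : Measure Ω} [IsProbabilityMeasure P]
    {h : ℝ → ℝ} (hd : IsDistortion h) (Z : Ω → ℝ) (a b : ℝ) :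
    IntervalIntegrable (fun t => h (P.real {ω | Z ω > t})) volume a b := by
  simpa using (hd.antitone_apply_measureReal (P := P) Z univ).intervalIntegrable

/-- For a random variable bounded by `M`, the distorted expectation is an integral over
`[-M, M]`. -/
theorem distExp_eq_intervalIntegral {P : Measure Ω} [IsProbabilityMeasure P] {h : ℝ → ℝ}
    (hd : IsDistortion h) {Z : Ω → ℝ} {M : ℝ} (hZ : ∀ ω, |Z ω| ≤ M) :
    distExp P h Z = (∫ t in (-M)..M, h (P.real {ω | Z ω > t})) - M := by
  have hM : 0 ≤ M := by
    obtain ⟨ω⟩ := nonempty_of_isProbabilityMeasure P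
    exact (abs_nonneg _).trans (hZ ω)
  have h_pos : ∫ x in Ioi (0:ℝ), h (P {ω | Z ω > x}).toReal
      = ∫ t in (0:ℝ)..M, h (P.real {ω | Z ω > t}) := by
    rw [intervalIntegral.integral_of_le hM]
    refine setIntegral_eq_of_subset_of_forall_sdiff_eq_zero measurableSet_Ioi
      Ioc_subset_Ioi_self fun t ht => ?_
    have hempty : {ω | Z ω > t} = ∅ := by
      ext ω
      simp only [mem_sdiff, mem_Ioi, mem_Ioc, not_and, not_le] at ht
      simpa using ((le_abs_self _).trans (hZ ω)).trans (ht.2 ht.1).le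
    simp [hempty, hd.2.1]
  have h_neg : ∫ x in Iio (0:ℝ), (h (P {ω | Z ω > x}).toReal - 1)
      = ∫ t in (-M)..(0:ℝ), (h (P.real {ω | Z ω > t}) - 1) := by
    rw [intervalIntegral.integral_of_le (by linarith), integral_Ioc_eq_integral_Ioo,
      ← integral_Ico_eq_integral_Ioo]
    refine setIntegral_eq_of_subset_of_forall_sdiff_eq_zero measurableSet_Iio
      Ico_subset_Iio_self fun t ht => ?_
    have huniv : {ω | Z ω > t} = univ := by
      ext ω
      simp only [mem_sdiff, mem_Iio, mem_Ico, not_and', not_le] at ht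
      simpa using (ht.2 ht.1).trans_le (abs_le.1 (hZ ω)).1
    simp [huniv, hd.2.2]
  rw [distExp, h_pos, h_neg, intervalIntegral.integral_sub (hd.intervalIntegrable _ _ _) (by simp),
    ← intervalIntegral.integral_add_adjacent_intervals (hd.intervalIntegrable Z (-M) 0)
      (hd.intervalIntegrable Z 0 M)]
  simp
  ring

theorem distExp_mono {P : Measure Ω} [IsProbabilityMeasure P] {h : ℝ → ℝ}
    (hd : IsDistortion h) {Z W : Ω → ℝ} (hZ : ∃ M, ∀ ω, |Z ω| ≤ M) (hW : ∃ M, ∀ ω, |W ω| ≤ M)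
    (hZW : ∀ᵐ ω ∂P, Z ω ≤ W ω) : distExp P h Z ≤ distExp P h W := by
  obtain ⟨M, hM⟩ := hZ
  obtain ⟨N, hN⟩ := hW
  obtain ⟨ω₀⟩ := nonempty_of_isProbabilityMeasure P
  have hM0 : 0 ≤ M := (abs_nonneg _).trans (hM ω₀)
  rw [distExp_eq_intervalIntegral hd (fun ω => (hM ω).trans (le_max_left M N)),
    distExp_eq_intervalIntegral hd (fun ω => (hN ω).trans (le_max_right M N))]
  gcongr
  refine intervalIntegral.integral_mono_on (by linarith [le_max_left M N])
    (hd.intervalIntegrable _ _ _) (hd.intervalIntegrable _ _ _) fun t _ =>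
      hd.apply_measureReal_mono (measure_mono_ae ?_)
  filter_upwards [hZW] with ω hω using fun (h1 : t < Z ω) => h1.trans_le hω

theorem ConvexOn.add_le_add_of_add_eq {s : Set ℝ} {h : ℝ → ℝ} (hc : ConvexOn ℝ s h)
    {p a b q : ℝ} (hp : p ∈ s) (hq : q ∈ s) (hpa : p ≤ a) (hpb : p ≤ b)
    (heq : a + b = p + q) : h a + h b ≤ h p + h q := by
  rcases eq_or_lt_of_le (show p ≤ q by linarith) with hpq | hpq
  · have ha : a = p := by linarith
    have hb : b = q := by linarith
    rw [ha, hb]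
  · have hne : q - p ≠ 0 := by linarith
    have hpos : 0 < q - p := by linarith
    have hsum : (q - a) / (q - p) + (a - p) / (q - p) = 1 := by field_simp; ring
    have hqa : 0 ≤ (q - a) / (q - p) := div_nonneg (by linarith) hpos.le
    have hap : 0 ≤ (a - p) / (q - p) := div_nonneg (by linarith) hpos.le
    have h1 := hc.2 hp hq hqa hap hsum
    have h2 := hc.2 hp hq hap hqa (by linarith)
    have e1 : ((q - a) / (q - p)) • p + ((a - p) / (q - p)) • q = a := by
      simp only [smul_eq_mul]; field_simp; ring
    have e2 : ((a - p) / (q - p)) • p + ((q - a) / (q - p)) • q = b := by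
      simp only [smul_eq_mul]; field_simp; nlinarith
    rw [e1] at h1
    rw [e2] at h2
    have hadd := add_le_add h1 h2
    simp only [smul_eq_mul] at hadd
    linear_combination hadd + (h p + h q) * hsum

/-- A convex distortion of a probability measure is a supermodular set function. -/
theorem supermodular_of_convexOn {P : Measure Ω} [IsProbabilityMeasure P] {h : ℝ → ℝ}
    (hc : ConvexOn ℝ (Icc 0 1) h) (A : Set Ω) {B : Set Ω}
    (hB : MeasurableSet B) :
    h (P.real A) + h (P.real B) ≤ h (P.real (A ∩ B)) + h (P.real (A ∪ B)) :=
  hc.add_le_add_of_add_eq ⟨measureReal_nonneg, measureReal_le_one⟩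
    ⟨measureReal_nonneg, measureReal_le_one⟩ (measureReal_mono inter_subset_left)
    (measureReal_mono inter_subset_right)
    (by rw [← measureReal_union_add_inter hB]; ring)

theorem add_indicator_gt_eq {α : Type*} (Z : α → ℝ) (B : Set α) {d : ℝ} (hd : 0 ≤ d) (t : ℝ) :
    {ω | Z ω + B.indicator (fun _ => d) ω > t}
      = {ω | Z ω > t} ∪ ({ω | Z ω > t - d} ∩ B) := by
  ext ω
  by_cases hω : ω ∈ B
  · simp only [hω, indicator_of_mem, mem_ofPred_eq, mem_union, mem_inter_iff, and_true]
    constructor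
    · intro h1; right; linarith
    · rintro (h1 | h1) <;> linarith
  · simp [hω]

theorem abs_add_indicator_le {α : Type*} {Z : α → ℝ} {M : ℝ} (hM : ∀ ω, |Z ω| ≤ M) (B : Set α)
    {d : ℝ} (hd : 0 ≤ d) (ω : α) : |Z ω + B.indicator (fun _ => d) ω| ≤ M + d := by
  refine (abs_add_le _ _).trans (add_le_add (hM ω) ?_)
  by_cases hω : ω ∈ B <;> simp [hω, abs_of_nonneg, hd]

theorem exists_abs_add_indicator_le {α : Type*} {Z : α → ℝ} (hZ : ∃ M, ∀ ω, |Z ω| ≤ M)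
    (B : Set α) {d : ℝ} (hd : 0 ≤ d) : ∃ M, ∀ ω, |Z ω + B.indicator (fun _ => d) ω| ≤ M :=
  hZ.imp' (· + d) fun _ hM => abs_add_indicator_le hM B hd

/-- The increment of the distorted expectation caused by adding a multiple of an indicator. -/
theorem integral_shift_sub_eq {P : Measure Ω} [IsProbabilityMeasure P] {h : ℝ → ℝ}
    (hh : IsDistortion h) {Z : Ω → ℝ} {M : ℝ} (hM : ∀ ω, |Z ω| ≤ M) (B : Set Ω)
    {d : ℝ} (hd : 0 ≤ d) :
    (∫ t in (-(M + d))..(M + d), h (P.real ({ω | Z ω > t - d} ∩ B)))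
      - (∫ t in (-(M + d))..(M + d), h (P.real ({ω | Z ω > t} ∩ B))) = d * h (P.real B) := by
  set G : ℝ → ℝ := fun t => h (P.real ({ω | Z ω > t} ∩ B)) with hG
  have hint : ∀ a b, IntervalIntegrable G volume a b := fun a b =>
    (hh.antitone_apply_measureReal (P := P) Z B).intervalIntegrable
  have e1 : (∫ t in (-(M + d))..(M + d), G (t - d)) = ∫ t in (-(M + d) - d)..M, G t := by
    rw [intervalIntegral.integral_comp_sub_right]; simp
  have e2 : ∫ t in (-(M + d) - d)..(-(M + d)), G t = d * h (P.real B) := by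
    have : ∫ t in (-(M + d) - d)..(-(M + d)), G t
        = ∫ t in (-(M + d) - d)..(-(M + d)), h (P.real B) := by
      refine intervalIntegral.integral_congr_ae ?_
      have hne : ∀ᵐ t : ℝ, t ≠ -(M + d) := by simp [ae_iff]
      filter_upwards [hne] with t hne ht
      rw [uIoc_of_le (by linarith)] at ht
      have : {ω | Z ω > t} = univ := by
        ext ω
        have := lt_of_le_of_ne ht.2 hne
        simp only [gt_iff_lt, mem_ofPred_eq, mem_univ, iff_true]
        linarith [(abs_le.1 (hM ω)).1]
      simp [hG, this]
    rw [this]; simp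
  have e3 : ∫ t in M..(M + d), G t = 0 := by
    have : ∫ t in M..(M + d), G t = ∫ t in M..(M + d), (0:ℝ) := by
      refine intervalIntegral.integral_congr fun t ht => ?_
      rw [uIcc_of_le (by linarith)] at ht
      have : {ω | Z ω > t} = ∅ := by
        ext ω
        simp only [gt_iff_lt, mem_ofPred_eq, mem_empty_iff_false, iff_false, not_lt]
        linarith [(abs_le.1 (hM ω)).2, ht.1]
      simp [hG, this, hh.2.1]
    rw [this]; simp
  have s1 := intervalIntegral.integral_add_adjacent_intervals
    (hint (-(M + d) - d) (-(M + d))) (hint (-(M + d)) M)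
  have s2 := intervalIntegral.integral_add_adjacent_intervals
    (hint (-(M + d)) M) (hint M (M + d))
  linarith

theorem le_distExp_add_indicator {P : Measure Ω} [IsProbabilityMeasure P] {h : ℝ → ℝ}
    (hh : IsDistortion h) (hc : ConvexOn ℝ (Icc 0 1) h) {Z : Ω → ℝ} (hZm : Measurable Z)
    (hZ : ∃ M, ∀ ω, |Z ω| ≤ M) {B : Set Ω} (hB : MeasurableSet B) {d : ℝ} (hd : 0 ≤ d) :
    distExp P h Z + d * h (P.real B)
      ≤ distExp P h fun ω => Z ω + B.indicator (fun _ => d) ω := by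
  obtain ⟨M, hM⟩ := hZ
  obtain ⟨ω₀⟩ := nonempty_of_isProbabilityMeasure P
  have hM0 : 0 ≤ M := (abs_nonneg _).trans (hM ω₀)
  rw [distExp_eq_intervalIntegral hh (fun ω => (hM ω).trans (by linarith : M ≤ M + d)),
    distExp_eq_intervalIntegral hh (abs_add_indicator_le hM B hd), ← integral_shift_sub_eq hh hM B hd]
  have i1 := hh.intervalIntegrable (P := P) Z (-(M + d)) (M + d)
  have i2 : IntervalIntegrable (fun t => h (P.real ({ω | Z ω > t - d} ∩ B))) volume
      (-(M + d)) (M + d) :=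
    Antitone.intervalIntegrable fun s t hst =>
      hh.antitone_apply_measureReal (P := P) Z B (sub_le_sub_right hst d)
  have i3 : IntervalIntegrable (fun t => h (P.real ({ω | Z ω > t} ∩ B))) volume
      (-(M + d)) (M + d) := (hh.antitone_apply_measureReal (P := P) Z B).intervalIntegrable
  have i4 := hh.intervalIntegrable (P := P) (fun ω => Z ω + B.indicator (fun _ => d) ω)
    (-(M + d)) (M + d)
  have key := intervalIntegral.integral_mono_on (by linarith) (i1.add i2) (i3.add i4)
    fun t _ => by
      have hset : {ω | Z ω > t} ∩ ({ω | Z ω > t - d} ∩ B) = {ω | Z ω > t} ∩ B := by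
        ext ω
        simp only [gt_iff_lt, mem_inter_iff, mem_ofPred_eq]
        exact ⟨fun h1 => ⟨h1.1, h1.2.2⟩, fun h1 => ⟨h1.1, by linarith [h1.1], h1.2⟩⟩
      have := supermodular_of_convexOn (P := P) hc {ω | Z ω > t}
        ((measurableSet_lt measurable_const hZm : MeasurableSet {ω | Z ω > t - d}).inter hB)
      rw [hset, ← add_indicator_gt_eq Z B hd t] at this
      exact this
  rw [intervalIntegral.integral_add i1 i2, intervalIntegral.integral_add i3 i4] at key
  linarith

/-- The distorted expectation is additive along an indicator of a set on which the random
variable is maximal. -/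
theorem distExp_add_indicator_of_isMax {P : Measure Ω} [IsProbabilityMeasure P] {h : ℝ → ℝ}
    (hh : IsDistortion h) {Z : Ω → ℝ}
    (hZ : ∃ M, ∀ ω, |Z ω| ≤ M) {B : Set Ω} (hB : ∀ ω ∈ B, ∀ ω', Z ω' ≤ Z ω)
    {d : ℝ} (hd : 0 ≤ d) :
    distExp P h (fun ω => Z ω + B.indicator (fun _ => d) ω)
      = distExp P h Z + d * h (P.real B) := by
  obtain ⟨M, hM⟩ := hZ
  obtain ⟨ω₀⟩ := nonempty_of_isProbabilityMeasure P
  have hM0 : 0 ≤ M := (abs_nonneg _).trans (hM ω₀)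
  rw [distExp_eq_intervalIntegral hh (fun ω => (hM ω).trans (by linarith : M ≤ M + d)),
    distExp_eq_intervalIntegral hh (abs_add_indicator_le hM B hd), ← integral_shift_sub_eq hh hM B hd]
  have i1 := hh.intervalIntegrable (P := P) Z (-(M + d)) (M + d)
  have i2 : IntervalIntegrable (fun t => h (P.real ({ω | Z ω > t - d} ∩ B))) volume
      (-(M + d)) (M + d) :=
    Antitone.intervalIntegrable fun s t hst =>
      hh.antitone_apply_measureReal (P := P) Z B (sub_le_sub_right hst d)
  have i3 : IntervalIntegrable (fun t => h (P.real ({ω | Z ω > t} ∩ B))) volume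
      (-(M + d)) (M + d) := (hh.antitone_apply_measureReal (P := P) Z B).intervalIntegrable
  have i4 := hh.intervalIntegrable (P := P) (fun ω => Z ω + B.indicator (fun _ => d) ω)
    (-(M + d)) (M + d)
  have key : (fun t => h (P.real {ω | Z ω > t}) + h (P.real ({ω | Z ω > t - d} ∩ B)))
      = fun t => h (P.real ({ω | Z ω > t} ∩ B))
        + h (P.real {ω | Z ω + B.indicator (fun _ => d) ω > t}) := by
    funext t
    rw [add_indicator_gt_eq Z B hd t]
    by_cases hsub : B ⊆ {ω | Z ω > t}
    · have hsub' : B ⊆ {ω | Z ω > t - d} := fun ω hω => by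
        have : Z ω > t := hsub hω
        simp only [gt_iff_lt, mem_ofPred_eq]
        linarith
      rw [inter_eq_right.2 hsub, inter_eq_right.2 hsub', union_eq_left.2 hsub, add_comm]
    · obtain ⟨ω, hω, hωt⟩ := not_subset.1 hsub
      have hempty : {ω | Z ω > t} = ∅ := by
        ext ω'
        simp only [gt_iff_lt, mem_ofPred_eq, not_lt, mem_empty_iff_false, iff_false] at hωt ⊢
        exact (hB ω hω ω').trans hωt
      simp [hempty]
  have key' := congrArg (fun φ : ℝ → ℝ => ∫ t in (-(M + d))..(M + d), φ t) key
  beta_reduce at key'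
  rw [intervalIntegral.integral_add i1 i2, intervalIntegral.integral_add i3 i4] at key'
  linarith

theorem distExp_add_const {P : Measure Ω} [IsProbabilityMeasure P] {h : ℝ → ℝ}
    (hh : IsDistortion h) {Z : Ω → ℝ} (hZ : ∃ M, ∀ ω, |Z ω| ≤ M) (a : ℝ) :
    distExp P h (fun ω => Z ω + a) = distExp P h Z + a := by
  have hpos : ∀ {W : Ω → ℝ} {d : ℝ}, (∃ M, ∀ ω, |W ω| ≤ M) → 0 ≤ d →
      distExp P h (fun ω => W ω + d) = distExp P h W + d := by
    rintro W d ⟨M, hM⟩ hd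
    rw [distExp_eq_intervalIntegral hh (fun ω => (hM ω).trans (by linarith : M ≤ M + d)),
      distExp_eq_intervalIntegral hh (M := M + d)
        (fun ω => (abs_add_le _ _).trans (add_le_add (hM ω) (abs_of_nonneg hd).le))]
    have hs := integral_shift_sub_eq (P := P) hh hM univ hd
    simp only [inter_univ, probReal_univ, hh.2.2, mul_one] at hs
    have hset : ∀ t, {ω | W ω + d > t} = {ω | W ω > t - d} := fun t => by
      ext ω
      simp [sub_lt_iff_lt_add]
    simp only [hset]
    linarith
  rcases le_total 0 a with ha | ha
  · exact hpos hZ ha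
  · obtain ⟨M, hM⟩ := hZ
    have := hpos (W := fun ω => Z ω + a) (d := -a)
      ⟨M + |a|, fun ω => (abs_add_le _ _).trans (add_le_add_left (hM ω) _)⟩ (by linarith)
    simp only [add_neg_cancel_right] at this
    linarith

theorem distExp_const {P : Measure Ω} [IsProbabilityMeasure P] {h : ℝ → ℝ}
    (hh : IsDistortion h) (a : ℝ) : distExp P h (fun _ : Ω => a) = a := by
  have h0 : distExp P h (fun _ : Ω => (0:ℝ)) = 0 := by
    rw [distExp_eq_intervalIntegral hh (M := 0) (by simp)]; simp
  simpa [h0] using distExp_add_const (P := P) hh (Z := fun _ => 0) ⟨0, by simp⟩ a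

/-- A finite chain in `ℝ × ℝ` lies on a monotone sequence starting from any given lower bound. -/
theorem exists_monotone_seq_of_isChain (Q : Finset (ℝ × ℝ)) (p₀ : ℝ × ℝ)
    (hQ : IsChain (· ≤ ·) (Q : Set (ℝ × ℝ))) (hp : ∀ q ∈ Q, p₀ ≤ q) :
    ∃ (n : ℕ) (p : ℕ → ℝ × ℝ), Monotone p ∧ p 0 = p₀ ∧ ∀ q ∈ Q, ∃ k ≤ n, p k = q := by
  induction Q using Finset.strongInduction generalizing p₀ with
  | H Q ih =>
    rcases Q.eq_empty_or_nonempty with rfl | hne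
    · exact ⟨0, fun _ => p₀, monotone_const, rfl, by simp⟩
    · obtain ⟨m, hm⟩ := Q.exists_minimal hne
      have hle : ∀ q ∈ Q, m ≤ q := fun q hq =>
        (hQ.total hm.prop hq).elim id fun hqm => hm.le_of_le hq hqm
      obtain ⟨n, p, hpm, hp0, hpQ⟩ := ih (Q.erase m) (Finset.erase_ssubset hm.prop) m
        (hQ.mono (by simp)) fun q hq => hle q (Finset.mem_of_mem_erase hq)
      refine ⟨n + 1, fun k => Nat.casesOn k p₀ p, monotone_nat_of_le_succ ?_, rfl, ?_⟩
      · rintro (_ | k)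
        · simpa [hp0] using hp m hm.prop
        · exact hpm k.le_succ
      · intro q hq
        by_cases hqm : q = m
        · exact ⟨1, by omega, by simp [hp0, hqm]⟩
        · obtain ⟨k, hk, hkq⟩ := hpQ q (Finset.mem_erase.2 ⟨hqm, hq⟩)
          exact ⟨k + 1, by omega, hkq⟩

/-- A bounded monotone function is uniformly approximated after composition with a monotone
function of finite range. -/
theorem exists_monotone_finite_range_abs_sub_le {F : ℝ → ℝ} (hF : Monotone F)
    (hb : ∃ K, ∀ x, |F x| ≤ K) {ε : ℝ} (hε : 0 < ε) :
    ∃ r : ℝ → ℝ, Monotone r ∧ (range r).Finite ∧ ∀ x, |F (r x) - F x| ≤ ε := by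
  obtain ⟨K, hK⟩ := hb
  set φ : ℝ → ℤ := fun x => ⌊F x / ε⌋ with hφ
  have hφm : Monotone φ := fun x y hxy => Int.floor_mono (by gcongr; exact hF hxy)
  have hr : ∀ x, φ (Function.invFun φ (φ x)) = φ x := fun x => Function.invFun_eq ⟨x, rfl⟩
  refine ⟨fun x => Function.invFun φ (φ x), fun x y hxy => ?_, ?_, fun x => ?_⟩
  · by_contra! hlt
    have h1 := hφm hlt.le
    rw [hr, hr] at h1
    have h2 := le_antisymm (hφm hxy) h1
    simp only [h2, lt_irrefl] at hlt
  · have hfin : (range φ).Finite := by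
      refine (finite_Icc ⌊-K / ε⌋ ⌊K / ε⌋).subset ?_
      rintro _ ⟨x, rfl⟩
      exact ⟨Int.floor_mono (by gcongr; exact (abs_le.1 (hK x)).1),
        Int.floor_mono (by gcongr; exact (abs_le.1 (hK x)).2)⟩
    have hcomp : range (fun x => Function.invFun φ (φ x)) = Function.invFun φ '' range φ := by
      rw [← range_comp]; rfl
    rw [hcomp]
    exact hfin.image _
  · have := Int.abs_sub_lt_one_of_floor_eq_floor (hr x)
    rw [← sub_div, abs_div, abs_of_pos hε, div_lt_one hε] at this
    exact this.le

theorem Submodular.sub_le_sub {c : ℝ → ℝ → ℝ} (hsub : Submodular c) {x₁ x₂ y₁ y₂ : ℝ}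
    (hx : x₁ ≤ x₂) (hy : y₁ ≤ y₂) : c x₂ y₂ + c x₁ y₁ ≤ c x₂ y₁ + c x₁ y₂ := by
  have := hsub x₂ y₁ x₁ y₂
  rw [min_eq_right hx, min_eq_left hy, max_eq_left hx, max_eq_right hy] at this
  linarith

/-- Along a monotone sequence, a monotone submodular cost dominates a sum of two
one-dimensional step functions. -/
theorem Submodular.add_sum_le {c : ℝ → ℝ → ℝ} (hsub : Submodular c)
    (hc : ∀ x₁ x₂ y₁ y₂, x₁ ≤ x₂ → y₁ ≤ y₂ → c x₁ y₁ ≤ c x₂ y₂) {x y : ℕ → ℝ}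
    (hx : Monotone x) (hy : Monotone y) {u v : ℝ} (hu : x 0 ≤ u) (hv : y 0 ≤ v) (n : ℕ) :
    c (x 0) (y 0) + ∑ k ∈ Finset.range n,
      ((Ici (x (k + 1))).indicator (fun _ => c (x (k + 1)) (y k) - c (x k) (y k)) u
        + (Ici (y (k + 1))).indicator (fun _ => c (x (k + 1)) (y (k + 1)) - c (x (k + 1)) (y k)) v)
      ≤ c (min u (x n)) (min v (y n)) := by
  induction n with
  | zero => simp [hu, hv]
  | succ n ih =>
    rw [Finset.sum_range_succ, ← add_assoc]
    have hxn := hx n.le_succ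
    have hyn := hy n.le_succ
    simp only [Nat.succ_eq_add_one] at hxn hyn
    have hu' : min u (x n) ≤ min u (x (n + 1)) := min_le_min_left _ hxn
    have hv' : min v (y n) ≤ min v (y (n + 1)) := min_le_min_left _ hyn
    by_cases h1 : x (n + 1) ≤ u <;> by_cases h2 : y (n + 1) ≤ v
    · simp only [mem_Ici, h1, h2, indicator_of_mem, min_eq_right, hxn.trans h1, hyn.trans h2]
        at ih ⊢
      linarith
    · simp only [mem_Ici, h1, h2, indicator_of_mem, min_eq_right, hxn.trans h1,
        not_false_eq_true, indicator_of_notMem] at ih ⊢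
      have a1 := hc _ _ _ _ (le_refl (x (n + 1))) hv'
      have a2 := hsub.sub_le_sub hxn (min_le_right v (y n))
      linarith
    · simp only [mem_Ici, h1, h2, indicator_of_mem, min_eq_right, hyn.trans h2,
        not_false_eq_true, indicator_of_notMem] at ih ⊢
      have a1 := hc _ _ _ _ hu' (le_refl (y n))
      have a2 := hsub.sub_le_sub (min_le_right u (x (n + 1))) hyn
      linarith
    · simp only [mem_Ici, h1, h2, not_false_eq_true, indicator_of_notMem] at ih ⊢
      have a1 := hc _ _ _ _ hu' hv'
      linarith

theorem le_distExp_add_sum_indicator {P : Measure Ω} [IsProbabilityMeasure P] {h : ℝ → ℝ}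
    (hh : IsDistortion h) (hc : ConvexOn ℝ (Icc 0 1) h) (a : ℝ) {d e : ℕ → ℝ} {A B : ℕ → Set Ω}
    (hd : ∀ k, 0 ≤ d k) (he : ∀ k, 0 ≤ e k) (hA : ∀ k, MeasurableSet (A k))
    (hB : ∀ k, MeasurableSet (B k)) (n : ℕ) :
    Measurable (fun ω => a + ∑ k ∈ Finset.range n,
      ((A k).indicator (fun _ => d k) ω + (B k).indicator (fun _ => e k) ω)) ∧
    (∃ M, ∀ ω, |a + ∑ k ∈ Finset.range n,
      ((A k).indicator (fun _ => d k) ω + (B k).indicator (fun _ => e k) ω)| ≤ M) ∧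
    a + ∑ k ∈ Finset.range n, (d k * h (P.real (A k)) + e k * h (P.real (B k)))
      ≤ distExp P h (fun ω => a + ∑ k ∈ Finset.range n,
      ((A k).indicator (fun _ => d k) ω + (B k).indicator (fun _ => e k) ω)) := by
  induction n with
  | zero => exact ⟨by simp, ⟨|a|, by simp⟩, by simp [distExp_const hh]⟩
  | succ n ih =>
    obtain ⟨hm, hb, hle⟩ := ih
    simp only [Finset.sum_range_succ, ← add_assoc]
    have hm' := hm.fun_add ((measurable_const (a := d n)).indicator (hA n))
    have hb' := exists_abs_add_indicator_le hb (A n) (hd n)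
    refine ⟨hm'.fun_add (measurable_const.indicator (hB n)),
      exists_abs_add_indicator_le hb' (B n) (he n), ?_⟩
    have h1 := le_distExp_add_indicator (P := P) hh hc hm hb (hA n) (hd n)
    have h2 := le_distExp_add_indicator (P := P) hh hc hm' hb' (hB n) (he n)
    linarith

theorem distExp_add_sum_indicator_of_antitone {P : Measure Ω} [IsProbabilityMeasure P] {h : ℝ → ℝ}
    (hh : IsDistortion h) (a : ℝ) {d : ℕ → ℝ} {B : ℕ → Set Ω}
    (hd : ∀ k, 0 ≤ d k) (hB : Antitone B) (n : ℕ) :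
    (∃ M, ∀ ω, |a + ∑ k ∈ Finset.range n, (B k).indicator (fun _ => d k) ω| ≤ M) ∧
    distExp P h (fun ω => a + ∑ k ∈ Finset.range n, (B k).indicator (fun _ => d k) ω)
      = a + ∑ k ∈ Finset.range n, d k * h (P.real (B k)) := by
  induction n with
  | zero => exact ⟨⟨|a|, by simp⟩, by simp [distExp_const hh]⟩
  | succ n ih =>
    obtain ⟨hb, heq⟩ := ih
    simp only [Finset.sum_range_succ, ← add_assoc]
    refine ⟨exists_abs_add_indicator_le hb (B n) (hd n), ?_⟩
    rw [distExp_add_indicator_of_isMax hh hb _ (hd n), heq]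
    intro ω hω ω'
    gcongr with k hk
    rw [indicator_of_mem (hB (Finset.mem_range.1 hk).le hω)]
    exact indicator_le_self' (fun _ _ => hd k) ω'

/-- Optimality of a comonotone pair taking finitely many values. -/
theorem distExp_le_of_monotone_seq {P : Measure Ω} [IsProbabilityMeasure P] {h : ℝ → ℝ}
    (hh : IsDistortion h) (hconv : ConvexOn ℝ (Icc 0 1) h) {c : ℝ → ℝ → ℝ} (hsub : Submodular c)
    (hc : ∀ x₁ x₂ y₁ y₂, x₁ ≤ x₂ → y₁ ≤ y₂ → c x₁ y₁ ≤ c x₂ y₂)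
    (hcb : ∃ K, ∀ x y, |c x y| ≤ K) {x y : ℕ → ℝ} (hx : Monotone x) (hy : Monotone y) {n : ℕ}
    {X Y X' Y' : Ω → ℝ} (hXm : Measurable X') (hYm : Measurable Y')
    (hX' : ∀ ω, x 0 ≤ X' ω) (hY' : ∀ ω, y 0 ≤ Y' ω)
    (hXY : ∀ ω, ∃ k ≤ n, X ω = x k ∧ Y ω = y k)
    (hXX' : ∀ t, P {ω | t ≤ X ω} = P {ω | t ≤ X' ω})
    (hYY' : ∀ t, P {ω | t ≤ Y ω} = P {ω | t ≤ Y' ω}) :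
    distExp P h (fun ω => c (X ω) (Y ω)) ≤ distExp P h (fun ω => c (X' ω) (Y' ω)) := by
  obtain ⟨K, hK⟩ := hcb
  have hd : ∀ k, 0 ≤ c (x (k + 1)) (y k) - c (x k) (y k) := fun k =>
    sub_nonneg.2 (hc _ _ _ _ (hx k.le_succ) le_rfl)
  have he : ∀ k, 0 ≤ c (x (k + 1)) (y (k + 1)) - c (x (k + 1)) (y k) := fun k =>
    sub_nonneg.2 (hc _ _ _ _ le_rfl (hy k.le_succ))
  have hD : ∀ k, 0 ≤ c (x (k + 1)) (y (k + 1)) - c (x k) (y k) := fun k => by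
    linarith [hd k, he k]
  obtain ⟨-, hlb, hl⟩ := le_distExp_add_sum_indicator (P := P) hh hconv (c (x 0) (y 0))
    (A := fun k => X' ⁻¹' Ici (x (k + 1))) (B := fun k => Y' ⁻¹' Ici (y (k + 1))) hd he
    (fun k => hXm measurableSet_Ici) (fun k => hYm measurableSet_Ici) n
  obtain ⟨hub, hu⟩ := distExp_add_sum_indicator_of_antitone (P := P) hh (c (x 0) (y 0))
    (B := fun k => {ω | x (k + 1) ≤ X ω ∧ y (k + 1) ≤ Y ω}) hD
    (fun j k hjk ω hω => ⟨(hx (Nat.succ_le_succ hjk)).trans hω.1,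
      (hy (Nat.succ_le_succ hjk)).trans hω.2⟩) n
  calc distExp P h (fun ω => c (X ω) (Y ω))
      ≤ _ := distExp_mono hh ⟨K, fun ω => hK _ _⟩ hub (.of_forall fun ω => ?_)
    _ = _ := hu
    _ ≤ _ := ?_
    _ ≤ _ := hl
    _ ≤ distExp P h (fun ω => c (X' ω) (Y' ω)) :=
      distExp_mono hh hlb ⟨K, fun ω => hK _ _⟩ (.of_forall fun ω =>
        (hsub.add_sum_le hc hx hy (hX' ω) (hY' ω) n).trans
          (hc _ _ _ _ (min_le_left _ _) (min_le_left _ _)))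
  · obtain ⟨j, hj, hXj, hYj⟩ := hXY ω
    have htel := Finset.sum_range_sub (fun k => c (x k) (y k)) j
    have hsum : ∑ k ∈ Finset.range j, (c (x (k + 1)) (y (k + 1)) - c (x k) (y k))
        ≤ ∑ k ∈ Finset.range n, {ω | x (k + 1) ≤ X ω ∧ y (k + 1) ≤ Y ω}.indicator
          (fun _ => c (x (k + 1)) (y (k + 1)) - c (x k) (y k)) ω := by
      refine (Finset.sum_le_sum fun k hk => ?_).trans
        (Finset.sum_le_sum_of_subset_of_nonneg (Finset.range_mono hj) fun k _ _ =>
          indicator_nonneg (fun _ _ => hD k) _)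
      have hkj : k + 1 ≤ j := Finset.mem_range.1 hk
      rw [indicator_of_mem]
      exact ⟨hXj ▸ hx hkj, hYj ▸ hy hkj⟩
    rw [hXj, hYj]
    linarith
  · gcongr with k
    have hA : h (P.real {ω | x (k + 1) ≤ X ω ∧ y (k + 1) ≤ Y ω})
        ≤ h (P.real (X' ⁻¹' Ici (x (k + 1)))) :=
      hh.apply_measureReal_mono ((measure_mono fun _ hω => hω.1).trans (hXX' _).le)
    have hB : h (P.real {ω | x (k + 1) ≤ X ω ∧ y (k + 1) ≤ Y ω})
        ≤ h (P.real (Y' ⁻¹' Ici (y (k + 1)))) :=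
      hh.apply_measureReal_mono ((measure_mono fun _ hω => hω.2).trans (hYY' _).le)
    linarith [mul_le_mul_of_nonneg_left hA (hd k), mul_le_mul_of_nonneg_left hB (he k)]

/-- Comonotone optimality for an increasing submodular cost that only depends on the truncation
of its arguments to `[-M, M]`. -/
theorem distExp_le_of_comonotone_of_truncated {P : Measure Ω} [IsProbabilityMeasure P] {h : ℝ → ℝ}
    (hh : IsDistortion h) (hconv : ConvexOn ℝ (Icc 0 1) h) {c : ℝ → ℝ → ℝ} (hsub : Submodular c)
    (hc : ∀ x₁ x₂ y₁ y₂, x₁ ≤ x₂ → y₁ ≤ y₂ → c x₁ y₁ ≤ c x₂ y₂) {M : ℝ}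
    (hcM : ∀ x y, c (max (-M) (min M x)) (max (-M) (min M y)) = c x y)
    {X Y X' Y' : Ω → ℝ} (hcom : Comonotone P X Y)
    (hXX' : IdentDistrib X X' P P) (hYY' : IdentDistrib Y Y' P P)
    (hXm : Measurable X') (hYm : Measurable Y') :
    distExp P h (fun ω => c (X ω) (Y ω)) ≤ distExp P h (fun ω => c (X' ω) (Y' ω)) := by
  have hlow : ∀ z : ℝ, -M ≤ max (-M) (min M z) := fun z => le_max_left _ _
  have hupp : ∀ z : ℝ, max (-M) (min M z) ≤ max (-M) M := fun z =>
    max_le_max le_rfl (min_le_left _ _)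
  have hbl : ∀ x y, c (-M) (-M) ≤ c x y := fun x y => by
    rw [← hcM x y]; exact hc _ _ _ _ (hlow _) (hlow _)
  have hbu : ∀ x y, c x y ≤ c (max (-M) M) (max (-M) M) := fun x y => by
    rw [← hcM x y]; exact hc _ _ _ _ (hupp _) (hupp _)
  have hcb : ∃ K, ∀ x y, |c x y| ≤ K :=
    ⟨max |c (-M) (-M)| |c (max (-M) M) (max (-M) M)|, fun x y =>
      abs_le_max_abs_abs (hbl x y) (hbu x y)⟩
  obtain ⟨K, hK⟩ := hcb
  have hlipx : ∀ x₁ x₂ y, x₁ ≤ x₂ → c x₂ y - c x₁ y ≤ c x₂ (-M) - c x₁ (-M) := by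
    intro x₁ x₂ y hx
    have := hsub.sub_le_sub hx (hlow y)
    have e : ∀ x, c x (max (-M) (min M y)) = c x y := fun x => by
      rw [← hcM x y, ← hcM x (max (-M) (min M y))]
      congr 1
      grind
    rw [e, e] at this
    linarith
  have hlipy : ∀ x y₁ y₂, y₁ ≤ y₂ → c x y₂ - c x y₁ ≤ c (-M) y₂ - c (-M) y₁ := by
    intro x y₁ y₂ hy
    have := hsub.sub_le_sub (hlow x) hy
    have e : ∀ y, c (max (-M) (min M x)) y = c x y := fun y => by
      rw [← hcM x y, ← hcM (max (-M) (min M x)) y]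
      congr 1
      grind
    rw [e, e] at this
    linarith
  have habsx : ∀ x₁ x₂ y, |c x₂ y - c x₁ y| ≤ |c x₂ (-M) - c x₁ (-M)| := by
    intro x₁ x₂ y
    rcases le_total x₁ x₂ with hx | hx
    · rw [abs_of_nonneg (sub_nonneg.2 (hc _ _ _ _ hx le_rfl)),
        abs_of_nonneg (sub_nonneg.2 (hc _ _ _ _ hx le_rfl))]
      exact hlipx _ _ _ hx
    · rw [abs_sub_comm, abs_sub_comm (c x₂ (-M)),
        abs_of_nonneg (sub_nonneg.2 (hc _ _ _ _ hx le_rfl)),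
        abs_of_nonneg (sub_nonneg.2 (hc _ _ _ _ hx le_rfl))]
      exact hlipx _ _ _ hx
  have habsy : ∀ x y₁ y₂, |c x y₂ - c x y₁| ≤ |c (-M) y₂ - c (-M) y₁| := by
    intro x y₁ y₂
    rcases le_total y₁ y₂ with hy | hy
    · rw [abs_of_nonneg (sub_nonneg.2 (hc _ _ _ _ le_rfl hy)),
        abs_of_nonneg (sub_nonneg.2 (hc _ _ _ _ le_rfl hy))]
      exact hlipy _ _ _ hy
    · rw [abs_sub_comm, abs_sub_comm (c (-M) y₂),
        abs_of_nonneg (sub_nonneg.2 (hc _ _ _ _ le_rfl hy)),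
        abs_of_nonneg (sub_nonneg.2 (hc _ _ _ _ le_rfl hy))]
      exact hlipy _ _ _ hy
  refine le_of_forall_pos_le_add fun ε hε => ?_
  obtain ⟨r, hrm, hrf, hr⟩ := exists_monotone_finite_range_abs_sub_le
    (F := fun x => c x (-M)) (fun _ _ hx => hc _ _ _ _ hx le_rfl) ⟨K, fun x => hK _ _⟩
    (show 0 < ε / 4 by linarith)
  obtain ⟨q, hqm, hqf, hq⟩ := exists_monotone_finite_range_abs_sub_le
    (F := fun y => c (-M) y) (fun _ _ hy => hc _ _ _ _ le_rfl hy) ⟨K, fun y => hK _ _⟩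
    (show 0 < ε / 4 by linarith)
  have happrox : ∀ x y, |c (r x) (q y) - c x y| ≤ ε / 2 := fun x y => by
    have h1 := (habsx x (r x) (q y)).trans (hr x)
    have h2 := (habsy x y (q y)).trans (hq y)
    rw [abs_le] at *
    constructor <;> linarith [h1.1, h1.2, h2.1, h2.2]
  obtain ⟨f, g, hf, hg, hfg⟩ := hcom
  set a : ℝ → ℝ := fun s => r (f s) with ha
  set b : ℝ → ℝ := fun s => q (g s) with hb
  obtain ⟨x₀, hx₀⟩ := hrf.bddBelow
  obtain ⟨y₀, hy₀⟩ := hqf.bddBelow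
  have hx₀ : ∀ x, x₀ ≤ r x := fun x => hx₀ (mem_range_self x)
  have hy₀ : ∀ x, y₀ ≤ q x := fun x => hy₀ (mem_range_self x)
  have hfin : (range fun s => (a s, b s)).Finite := by
    refine (hrf.prod hqf).subset ?_
    rintro _ ⟨s, rfl⟩
    exact ⟨mem_range_self _, mem_range_self _⟩
  have hmono : Monotone fun s => (a s, b s) := fun s t hst => ⟨hrm (hf hst), hqm (hg hst)⟩
  obtain ⟨n, p, hp, hp0, hpk⟩ := exists_monotone_seq_of_isChain hfin.toFinset (x₀, y₀)
    (by simpa using hmono.isChain_range) (by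
      intro z hz
      obtain ⟨s, rfl⟩ := hfin.mem_toFinset.1 hz
      exact ⟨hx₀ _, hy₀ _⟩)
  have key := distExp_le_of_monotone_seq (P := P) hh hconv hsub hc ⟨K, hK⟩
    (x := fun k => (p k).1) (y := fun k => (p k).2) (n := n)
    (fun _ _ hij => (hp hij).1) (fun _ _ hij => (hp hij).2)
    (X := fun ω => a (X ω + Y ω)) (Y := fun ω => b (X ω + Y ω))
    (X' := fun ω => r (X' ω)) (Y' := fun ω => q (Y' ω))
    (hrm.measurable.comp hXm) (hqm.measurable.comp hYm)
    (fun ω => by simpa [hp0] using hx₀ _) (fun ω => by simpa [hp0] using hy₀ _)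
    (fun ω => by
      obtain ⟨k, hk, hpe⟩ := hpk (a (X ω + Y ω), b (X ω + Y ω)) (hfin.mem_toFinset.2 ⟨_, rfl⟩)
      exact ⟨k, hk, by simp [hpe], by simp [hpe]⟩)
    (fun t => by
      have h1 : P {ω | t ≤ a (X ω + Y ω)} = P {ω | t ≤ r (X ω)} := by
        refine measure_congr ?_
        filter_upwards [hfg] with ω hω
        change (t ≤ r (f (X ω + Y ω))) = (t ≤ r (X ω))
        rw [← hω.1]
      rw [h1]
      exact (hXX'.comp hrm.measurable).measure_mem_eq measurableSet_Ici)
    (fun t => by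
      have h1 : P {ω | t ≤ b (X ω + Y ω)} = P {ω | t ≤ q (Y ω)} := by
        refine measure_congr ?_
        filter_upwards [hfg] with ω hω
        change (t ≤ q (g (X ω + Y ω))) = (t ≤ q (Y ω))
        rw [← hω.2]
      rw [h1]
      exact (hYY'.comp hqm.measurable).measure_mem_eq measurableSet_Ici)
  have hbdd : ∀ (U V : Ω → ℝ) (e : ℝ), ∃ N, ∀ ω, |c (U ω) (V ω) + e| ≤ N := fun U V e =>
    ⟨K + |e|, fun ω => (abs_add_le _ _).trans (add_le_add_left (hK _ _) _)⟩
  have hbdd0 : ∀ (U V : Ω → ℝ), ∃ N, ∀ ω, |c (U ω) (V ω)| ≤ N := fun U V => ⟨K, fun ω => hK _ _⟩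
  have hup : distExp P h (fun ω => c (X ω) (Y ω))
      ≤ distExp P h (fun ω => c (a (X ω + Y ω)) (b (X ω + Y ω))) + ε / 2 := by
    rw [← distExp_add_const hh (hbdd0 _ _)]
    refine distExp_mono hh (hbdd0 _ _) (hbdd _ _ _) ?_
    filter_upwards [hfg] with ω hω
    simp only [ha, hb, ← hω.1, ← hω.2]
    linarith [(abs_le.1 (happrox (X ω) (Y ω))).1]
  have hlo : distExp P h (fun ω => c (r (X' ω)) (q (Y' ω)))
      ≤ distExp P h (fun ω => c (X' ω) (Y' ω)) + ε / 2 := by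
    rw [← distExp_add_const hh (hbdd0 _ _)]
    refine distExp_mono hh (hbdd0 _ _) (hbdd _ _ _) (.of_forall fun ω => ?_)
    linarith [(abs_le.1 (happrox (X' ω) (Y' ω))).2]
  linarith

/-- Comonotone optimality for an increasing submodular cost. -/
theorem distExp_le_of_comonotone_of_monotone {P : Measure Ω} [IsProbabilityMeasure P] {h : ℝ → ℝ}
    (hh : IsDistortion h) (hconv : ConvexOn ℝ (Icc 0 1) h) {c : ℝ → ℝ → ℝ} (hsub : Submodular c)
    (hc : ∀ x₁ x₂ y₁ y₂, x₁ ≤ x₂ → y₁ ≤ y₂ → c x₁ y₁ ≤ c x₂ y₂)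
    {X Y X' Y' : Ω → ℝ} (hX : IsBddRV X) (hY : IsBddRV Y) (hX' : IsBddRV X') (hY' : IsBddRV Y')
    (hcom : Comonotone P X Y)
    (hXX' : IdentDistrib X X' P P) (hYY' : IdentDistrib Y Y' P P) :
    distExp P h (fun ω => c (X ω) (Y ω)) ≤ distExp P h (fun ω => c (X' ω) (Y' ω)) := by
  obtain ⟨-, M₁, hM₁⟩ := hX
  obtain ⟨-, M₂, hM₂⟩ := hY
  obtain ⟨hXm', M₃, hM₃⟩ := hX'
  obtain ⟨hYm', M₄, hM₄⟩ := hY'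
  set M := max (max M₁ M₂) (max M₃ M₄) with hM
  have hcl : ∀ z, |z| ≤ M → max (-M) (min M z) = z := fun z hz => by
    rw [min_eq_right (abs_le.1 hz).2, max_eq_right (abs_le.1 hz).1]
  have hclm : Monotone fun z => max (-M) (min M z) := fun s t hst =>
    max_le_max le_rfl (min_le_min le_rfl hst)
  have key := distExp_le_of_comonotone_of_truncated (P := P) hh hconv
    (c := fun x y => c (max (-M) (min M x)) (max (-M) (min M y))) (M := M)
    (fun x₁ y₁ x₂ y₂ => by
      have := hsub (max (-M) (min M x₁)) (max (-M) (min M y₁))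
        (max (-M) (min M x₂)) (max (-M) (min M y₂))
      rwa [← hclm.map_min, ← hclm.map_max, ← hclm.map_min, ← hclm.map_max] at this)
    (fun x₁ x₂ y₁ y₂ hx hy => hc _ _ _ _ (hclm hx) (hclm hy))
    (fun x y => by congr 1 <;> grind) hcom hXX' hYY' hXm' hYm'
  have e1 : ∀ ω, max (-M) (min M (X ω)) = X ω := fun ω => hcl _ ((hM₁ ω).trans (by simp [hM]))
  have e2 : ∀ ω, max (-M) (min M (Y ω)) = Y ω := fun ω => hcl _ ((hM₂ ω).trans (by simp [hM]))
  have e3 : ∀ ω, max (-M) (min M (X' ω)) = X' ω := fun ω => hcl _ ((hM₃ ω).trans (by simp [hM]))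
  have e4 : ∀ ω, max (-M) (min M (Y' ω)) = Y' ω := fun ω => hcl _ ((hM₄ ω).trans (by simp [hM]))
  simpa only [e1, e2, e3, e4] using key

theorem IsBddRV.neg {X : Ω → ℝ} (hX : IsBddRV X) : IsBddRV fun ω => -X ω :=
  ⟨hX.1.neg, hX.2.imp fun _ hM ω => (abs_neg (X ω)).trans_le (hM ω)⟩

theorem Comonotone.neg {P : Measure Ω} {X Y : Ω → ℝ} (hcom : Comonotone P X Y) :
    Comonotone P (fun ω => -X ω) (fun ω => -Y ω) := by
  obtain ⟨f, g, hf, hg, hfg⟩ := hcom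
  refine ⟨fun s => -f (-s), fun s => -g (-s), fun s t hst => neg_le_neg (hf (neg_le_neg hst)),
    fun s t hst => neg_le_neg (hg (neg_le_neg hst)), ?_⟩
  filter_upwards [hfg] with ω hω
  have : -(-X ω + -Y ω) = X ω + Y ω := by ring
  simp only [this, neg_inj]
  exact hω

theorem Submodular.comp_neg {c : ℝ → ℝ → ℝ} (hsub : Submodular c) :
    Submodular fun x y => c (-x) (-y) := fun x₁ y₁ x₂ y₂ => by
  have := hsub (-x₁) (-y₁) (-x₂) (-y₂)
  simp only [min_neg_neg, max_neg_neg] at this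
  linarith

/-- For a convex distortion function h and a monotone submodular cost c,
the comonotonic coupling is universally optimal for (c, h). -/
theorem comonotonic_univOptimal_of_convex_submodular
    (P : Measure Ω) [IsProbabilityMeasure P] (hP : AtomlessProb P)
    (h : ℝ → ℝ) (hdist : IsDistortion h) (hconv : ConvexOn ℝ (Icc 0 1) h)
    (c : ℝ → ℝ → ℝ) (hsub : Submodular c) (hmono : MonotoneCost c)
    (X Y X' Y' : Ω → ℝ)
    (hX : IsBddRV X) (hY : IsBddRV Y) (hX' : IsBddRV X') (hY' : IsBddRV Y')
    (hcom : Comonotone P X Y)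
    (hXX' : IdentDistrib X X' P P) (hYY' : IdentDistrib Y Y' P P) :
    distExp P h (fun ω => c (X ω) (Y ω)) ≤ distExp P h (fun ω => c (X' ω) (Y' ω)) := by
  rcases hmono with hm | hm
  · exact distExp_le_of_comonotone_of_monotone hdist hconv hsub
      (fun x₁ x₂ y₁ y₂ hx hy => hm (show (x₁, y₁) ≤ (x₂, y₂) from ⟨hx, hy⟩))
      hX hY hX' hY' hcom hXX' hYY'
  · simpa only [neg_neg] using distExp_le_of_comonotone_of_monotone hdist hconv hsub.comp_neg
      (fun x₁ x₂ y₁ y₂ hx hy =>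
        hm (show (-x₂, -y₂) ≤ (-x₁, -y₁) from ⟨neg_le_neg hx, neg_le_neg hy⟩))
      hX.neg hY.neg hX'.neg hY'.neg hcom.neg (hXX'.comp measurable_neg) (hYY'.comp measurable_neg)
end
end

section
/- Weak duality for convex distortions: Let h be a convex distortion function, let c:ℝ²→ℝ be a measurable cost function, and let φ,ψ:ℝ→ℝ be bounded measurable functions with φ(x)+ψ(y) ≤ c(x,y) for all x,y∈ℝ. Then for all bounded random variables X and Y (with any joint dependence), E^h[c(X,Y)] ≥ E^h[φ(X)] + E^h[ψ(Y)], provided c(X,Y) is bounded. In particular, inf over all couplings of E^h[c(X,Y)] with X ∼ μ, Y ∼ ν is at least sup over all such pairs (φ,ψ) of E^h[φ(X^μ)] + E^h[ψ(X^ν)], where X^μ ∼ μ and X^ν ∼ ν. -/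
open MeasureTheory Set ProbabilityTheory

noncomputable section

variable {Ω : Type*} [MeasurableSpace Ω]

/-- The survival function `x ↦ P(Z > x)`. -/
def survival (P : Measure Ω) (Z : Ω → ℝ) (x : ℝ) : ℝ := (P {ω | Z ω > x}).toReal

lemma survival_mem_Icc (P : Measure Ω) [IsProbabilityMeasure P] (Z : Ω → ℝ) (x : ℝ) :
    survival P Z x ∈ Icc (0 : ℝ) 1 :=
  ⟨ENNReal.toReal_nonneg, measureReal_le_one⟩

lemma antitone_survival (P : Measure Ω) [IsProbabilityMeasure P] (Z : Ω → ℝ) :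
    Antitone (survival P Z) := fun _ _ hxy =>
  measureReal_mono fun _ hω => lt_of_le_of_lt hxy hω

lemma antitone_comp_survival (P : Measure Ω) [IsProbabilityMeasure P] (Z : Ω → ℝ) {h : ℝ → ℝ}
    (hh : MonotoneOn h (Icc 0 1)) : Antitone (fun x => h (survival P Z x)) := fun _ _ hxy =>
  hh (survival_mem_Icc P Z _) (survival_mem_Icc P Z _) (antitone_survival P Z hxy)

lemma integrable_min_const (P : Measure Ω) [IsFiniteMeasure P] {Z : Ω → ℝ}
    (hZ : Measurable Z) (hZ0 : ∀ ω, 0 ≤ Z ω) {m : ℝ} (hm : 0 ≤ m) :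
    Integrable (fun ω => min (Z ω) m) P :=
  Integrable.of_bound (hZ.min measurable_const).aestronglyMeasurable m
    (Filter.Eventually.of_forall fun ω => by
      rw [Real.norm_eq_abs, abs_of_nonneg (le_min (hZ0 ω) hm)]
      exact min_le_right _ _)

lemma integral_survival_eq (P : Measure Ω) [IsProbabilityMeasure P] {Z : Ω → ℝ}
    (hZ : Measurable Z) (hZ0 : ∀ ω, 0 ≤ Z ω) {m : ℝ} (hm : 0 ≤ m) :
    ∫ x in (0 : ℝ)..m, survival P Z x = ∫ ω, min (Z ω) m ∂P := by
  rw [(integrable_min_const P hZ hZ0 hm).integral_eq_integral_meas_lt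
    (Filter.Eventually.of_forall fun ω => le_min (hZ0 ω) hm),
    intervalIntegral.integral_of_le hm, integral_Ioc_eq_integral_Ioo]
  have hlt : ∀ x ∈ Ioo (0 : ℝ) m, survival P Z x = P.real {ω | x < min (Z ω) m} := fun x hx => by
    simp only [lt_min_iff, hx.2, and_true]
    rfl
  rw [setIntegral_congr_fun measurableSet_Ioo hlt]
  refine (setIntegral_eq_of_subset_of_forall_sdiff_eq_zero measurableSet_Ioi
    Ioo_subset_Ioi_self fun x hx => ?_).symm
  have hmx : m ≤ x := by
    by_contra! hxm
    exact hx.2 ⟨hx.1, hxm⟩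
  simp [hmx.not_gt]

lemma exists_antitone_threshold {S : ℝ → ℝ} (hS : Antitone S) (a : ℝ) {b : ℝ} (hb : 0 ≤ b) :
    ∃ q ∈ Icc (0 : ℝ) b, (∀ x, x < q → a ≤ S x ∨ x < 0) ∧ ∀ x, q < x → x ≤ b → S x ≤ a := by
  set T : Set ℝ := {x | x ∈ Icc 0 b ∧ (x = 0 ∨ a ≤ S x)}
  have hT0 : (0 : ℝ) ∈ T := ⟨⟨le_rfl, hb⟩, Or.inl rfl⟩
  have hTb : BddAbove T := ⟨b, fun x hx => hx.1.2⟩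
  refine ⟨sSup T, ⟨le_csSup hTb hT0, csSup_le ⟨0, hT0⟩ fun x hx => hx.1.2⟩, ?_, ?_⟩
  · intro x hx
    obtain ⟨y, ⟨_, hy⟩, hxy⟩ := exists_lt_of_lt_csSup ⟨0, hT0⟩ hx
    rcases hy with rfl | hy
    · exact Or.inr hxy
    · exact Or.inl (hy.trans (hS hxy.le))
  · intro x hx hxb
    by_contra! hlt
    exact hx.not_ge (le_csSup hTb ⟨⟨(le_csSup hTb hT0).trans hx.le, hxb⟩, Or.inr hlt.le⟩)

lemma intervalIntegrable_hinge {S : ℝ → ℝ} (hS : Antitone S) (a u v : ℝ) :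
    IntervalIntegrable (fun x => max (S x - a) 0) volume u v :=
  Antitone.intervalIntegrable fun _ _ hxy =>
    max_le_max (sub_le_sub_right (hS hxy) a) le_rfl

lemma integral_antitone_sub_const {S : ℝ → ℝ} (hS : Antitone S) (a m : ℝ) :
    ∫ x in (0 : ℝ)..m, (S x - a) = (∫ x in (0 : ℝ)..m, S x) - a * m := by
  rw [intervalIntegral.integral_sub hS.intervalIntegrable intervalIntegrable_const]
  simp [mul_comm]

lemma integral_sub_le_integral_hinge {S : ℝ → ℝ} (hS : Antitone S) (a : ℝ) {b m : ℝ}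
    (hm : m ∈ Icc (0 : ℝ) b) :
    (∫ x in (0 : ℝ)..m, S x) - a * m ≤ ∫ x in (0 : ℝ)..b, max (S x - a) 0 := by
  rw [← integral_antitone_sub_const hS, ← intervalIntegral.integral_add_adjacent_intervals
    (intervalIntegrable_hinge hS a 0 m) (intervalIntegrable_hinge hS a m b)]
  have h1 : ∫ x in (0 : ℝ)..m, (S x - a) ≤ ∫ x in (0 : ℝ)..m, max (S x - a) 0 :=
    intervalIntegral.integral_mono_on hm.1 (hS.intervalIntegrable.sub intervalIntegrable_const)
      (intervalIntegrable_hinge hS a 0 m) fun x _ => le_max_left _ _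
  have h2 : 0 ≤ ∫ x in m..b, max (S x - a) 0 :=
    intervalIntegral.integral_nonneg hm.2 fun x _ => le_max_right _ _
  linarith

lemma exists_integral_hinge_eq {S : ℝ → ℝ} (hS : Antitone S) (a : ℝ) {b : ℝ} (hb : 0 ≤ b) :
    ∃ q ∈ Icc (0 : ℝ) b,
      ∫ x in (0 : ℝ)..b, max (S x - a) 0 = (∫ x in (0 : ℝ)..q, S x) - a * q := by
  obtain ⟨q, hq, hlt, hgt⟩ := exists_antitone_threshold hS a hb
  refine ⟨q, hq, ?_⟩
  have h1 : ∫ x in (0 : ℝ)..q, max (S x - a) 0 = ∫ x in (0 : ℝ)..q, (S x - a) := by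
    rw [intervalIntegral.integral_of_le hq.1, intervalIntegral.integral_of_le hq.1,
      integral_Ioc_eq_integral_Ioo, integral_Ioc_eq_integral_Ioo]
    refine setIntegral_congr_fun measurableSet_Ioo fun x hx => max_eq_left ?_
    rcases hlt x hx.2 with h | h
    · linarith
    · exact absurd hx.1 h.not_gt
  have h2 : ∫ x in q..b, max (S x - a) 0 = 0 := by
    rw [intervalIntegral.integral_of_le hq.2]
    refine setIntegral_eq_zero_of_forall_eq_zero fun x hx => max_eq_right ?_
    linarith [hgt x hx.1 hx.2]
  rw [← integral_antitone_sub_const hS, ← h1, ← intervalIntegral.integral_add_adjacent_intervals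
    (intervalIntegrable_hinge hS a 0 q) (intervalIntegrable_hinge hS a q b), h2, add_zero]

lemma integral_hinge_survival_superadditive (P : Measure Ω) [IsProbabilityMeasure P]
    {U V W : Ω → ℝ} (hU : Measurable U) (hV : Measurable V) (hW : Measurable W)
    (hU0 : ∀ ω, 0 ≤ U ω) (hV0 : ∀ ω, 0 ≤ V ω) (hUVW : ∀ ω, U ω + V ω ≤ W ω)
    (a : ℝ) {b : ℝ} (hb : 0 ≤ b) :
    (∫ x in (0 : ℝ)..b, max (survival P U x - a) 0) +
      (∫ x in (0 : ℝ)..b, max (survival P V x - a) 0) ≤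
      ∫ x in (0 : ℝ)..(2 * b), max (survival P W x - a) 0 := by
  have hW0 : ∀ ω, 0 ≤ W ω := fun ω => by linarith [hU0 ω, hV0 ω, hUVW ω]
  obtain ⟨p, hp, hpU⟩ := exists_integral_hinge_eq (antitone_survival P U) a hb
  obtain ⟨q, hq, hqV⟩ := exists_integral_hinge_eq (antitone_survival P V) a hb
  have hpq : p + q ∈ Icc (0 : ℝ) (2 * b) :=
    ⟨add_nonneg hp.1 hq.1, by linarith [hp.2, hq.2]⟩
  refine le_trans ?_ (integral_sub_le_integral_hinge (antitone_survival P W) a hpq)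
  rw [hpU, hqV, integral_survival_eq P hU hU0 hp.1, integral_survival_eq P hV hV0 hq.1,
    integral_survival_eq P hW hW0 hpq.1]
  have key : (∫ ω, min (U ω) p ∂P) + (∫ ω, min (V ω) q ∂P) ≤ ∫ ω, min (W ω) (p + q) ∂P := by
    rw [← integral_add (integrable_min_const P hU hU0 hp.1)
      (integrable_min_const P hV hV0 hq.1)]
    refine integral_mono
      ((integrable_min_const P hU hU0 hp.1).add (integrable_min_const P hV hV0 hq.1))
      (integrable_min_const P hW hW0 hpq.1) fun ω => le_min ?_ (add_le_add (min_le_right _ _) (min_le_right _ _))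
    exact (add_le_add (min_le_left _ _) (min_le_left _ _)).trans (hUVW ω)
  linarith

/-- The piecewise linear interpolation of `h` on the grid `k / N`, as a combination of hinges. -/
def hingeInterp (h : ℝ → ℝ) (N : ℕ) (t : ℝ) : ℝ :=
  ∑ k ∈ Finset.range N,
    ((h ((k + 1 : ℕ) / N) - h ((k : ℕ) / N)) - (h ((k : ℕ) / N) - h ((k - 1 : ℕ) / N))) * N *
      max (t - k / N) 0

lemma sum_secondDiff_mul (g : ℕ → ℝ) (j : ℕ) :
    ∑ k ∈ Finset.range j, ((g (k + 1) - g k) - (g k - g (k - 1))) * ((j : ℝ) - k) = g j - g 0 := by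
  have h1 : ∀ j : ℕ, ∑ k ∈ Finset.range (j + 1), ((g (k + 1) - g k) - (g k - g (k - 1))) =
      g (j + 1) - g j := by
    intro j
    induction j with
    | zero => simp
    | succ j ih => rw [Finset.sum_range_succ, ih]; simp
  induction j with
  | zero => simp
  | succ j ih =>
    have : ∀ k ∈ Finset.range (j + 1),
        ((g (k + 1) - g k) - (g k - g (k - 1))) * (((j + 1 : ℕ) : ℝ) - k) =
        ((g (k + 1) - g k) - (g k - g (k - 1))) * ((j : ℝ) - k) +
          ((g (k + 1) - g k) - (g k - g (k - 1))) := fun k _ => by push_cast; ring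
    rw [Finset.sum_congr rfl this, Finset.sum_add_distrib, h1, Finset.sum_range_succ, ih]
    ring

lemma hingeInterp_grid {h : ℝ → ℝ} (h0 : h 0 = 0) {N j : ℕ} (hN : 0 < N) (hj : j ≤ N) :
    hingeInterp h N (j / N) = h (j / N) := by
  have hN' : (0 : ℝ) < N := by exact_mod_cast hN
  have hs := sum_secondDiff_mul (fun k => h ((k : ℕ) / N)) j
  simp only [Nat.cast_zero, zero_div, h0, sub_zero] at hs
  rw [← hs, hingeInterp, ← Finset.sum_subset (Finset.range_subset_range.2 hj)]
  · refine Finset.sum_congr rfl fun k hk => ?_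
    have hkj : (k : ℝ) ≤ j := by exact_mod_cast (Finset.mem_range.1 hk).le
    rw [max_eq_left (by rw [← sub_div]; exact div_nonneg (by linarith) hN'.le)]
    field_simp
  · intro k _ hk
    have hkj : (j : ℝ) ≤ k := by exact_mod_cast not_lt.1 (Finset.mem_range.not.1 hk)
    rw [max_eq_right (by rw [← sub_div]; exact div_nonpos_of_nonpos_of_nonneg (by linarith) hN'.le),
      mul_zero]

lemma secondDiff_nonneg {h : ℝ → ℝ} (hmono : MonotoneOn h (Icc 0 1))
    (hconv : ConvexOn ℝ (Icc 0 1) h) {N k : ℕ} (hk : k < N) :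
    0 ≤ (h ((k + 1 : ℕ) / N) - h ((k : ℕ) / N)) - (h ((k : ℕ) / N) - h ((k - 1 : ℕ) / N)) := by
  have hN' : (0 : ℝ) < N := by exact_mod_cast (Nat.zero_le k).trans_lt hk
  have hmem : ∀ i : ℕ, i ≤ N → (i : ℝ) / N ∈ Icc (0 : ℝ) 1 := fun i hi =>
    ⟨by positivity, (div_le_one hN').2 (by exact_mod_cast hi)⟩
  rcases k with _ | k
  · have := hmono (hmem 0 (by omega)) (hmem 1 hk) (by gcongr; norm_num)
    simpa using this
  · have := hconv.2 (hmem k (by omega)) (hmem (k + 2) hk) (by norm_num : (0 : ℝ) ≤ 1 / 2)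
      (by norm_num : (0 : ℝ) ≤ 1 / 2) (by norm_num)
    have e : (1 / 2 : ℝ) • ((k : ℝ) / N) + (1 / 2 : ℝ) • (((k + 2 : ℕ) : ℝ) / N) =
        ((k + 1 : ℕ) : ℝ) / N := by
      simp only [smul_eq_mul]; push_cast; field_simp; ring
    rw [e] at this
    simp only [smul_eq_mul] at this
    simp only [Nat.add_sub_cancel, add_assoc, Nat.reduceAdd]
    linarith

lemma monotone_hingeInterp {h : ℝ → ℝ} (hmono : MonotoneOn h (Icc 0 1))
    (hconv : ConvexOn ℝ (Icc 0 1) h) (N : ℕ) : Monotone (hingeInterp h N) := fun _ _ hst =>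
  Finset.sum_le_sum fun _ hk => mul_le_mul_of_nonneg_left
    (max_le_max (sub_le_sub_right hst _) le_rfl)
    (mul_nonneg (secondDiff_nonneg hmono hconv (Finset.mem_range.1 hk)) N.cast_nonneg)

lemma continuousWithinAt_of_convexOn_Icc {h : ℝ → ℝ} (hdist : IsDistortion h)
    (hconv : ConvexOn ℝ (Icc 0 1) h) {t : ℝ} (ht : t ∈ Ico (0 : ℝ) 1) :
    ContinuousWithinAt h (Icc 0 1) t := by
  rcases ht.1.eq_or_lt with rfl | h0
  · have hbd : ∀ s ∈ Icc (0 : ℝ) 1, 0 ≤ h s ∧ h s ≤ s := fun s hs => by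
      refine ⟨hdist.2.1 ▸ hdist.1 (by simp) hs hs.1, ?_⟩
      have := hconv.2 (by simp : (0 : ℝ) ∈ Icc (0 : ℝ) 1) (by simp : (1 : ℝ) ∈ Icc (0 : ℝ) 1)
        (sub_nonneg.2 hs.2) hs.1 (by ring)
      simpa [hdist.2.1, hdist.2.2] using this
    rw [ContinuousWithinAt, hdist.2.1]
    refine tendsto_of_tendsto_of_tendsto_of_le_of_le' tendsto_const_nhds
      (Filter.tendsto_id.mono_left nhdsWithin_le_nhds) ?_ ?_
    · filter_upwards [self_mem_nhdsWithin] with s hs using (hbd s hs).1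
    · filter_upwards [self_mem_nhdsWithin] with s hs using (hbd s hs).2
  · have hc := (hconv.subset Ioo_subset_Icc_self (convex_Ioo 0 1)).continuousOn isOpen_Ioo
    exact (hc.continuousAt (Ioo_mem_nhds h0 ht.2)).continuousWithinAt

lemma tendsto_hingeInterp {h : ℝ → ℝ} (hdist : IsDistortion h)
    (hconv : ConvexOn ℝ (Icc 0 1) h) {t : ℝ} (ht : t ∈ Icc (0 : ℝ) 1) :
    Filter.Tendsto (fun n : ℕ => hingeInterp h (n + 1) t) Filter.atTop (nhds (h t)) := by
  rcases ht.2.eq_or_lt with rfl | ht1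
  · have : ∀ n : ℕ, hingeInterp h (n + 1) 1 = h 1 := fun n => by
      have := hingeInterp_grid hdist.2.1 (Nat.succ_pos n) (le_refl (n + 1))
      rwa [div_self (by positivity)] at this
    simp [this]
  have hcont := continuousWithinAt_of_convexOn_Icc hdist hconv ⟨ht.1, ht1⟩
  have hpos : ∀ n : ℕ, (0 : ℝ) < ((n + 1 : ℕ) : ℝ) := fun n => by positivity
  set j : ℕ → ℕ := fun n => ⌊t * ((n + 1 : ℕ) : ℝ)⌋₊
  have hjle : ∀ n, (j n : ℝ) ≤ t * ((n + 1 : ℕ) : ℝ) := fun n =>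
    Nat.floor_le (mul_nonneg ht.1 (hpos n).le)
  have hjlt : ∀ n, t * ((n + 1 : ℕ) : ℝ) < j n + 1 := fun n => Nat.lt_floor_add_one _
  have hjN : ∀ n, j n + 1 ≤ n + 1 := fun n => by
    have : (j n : ℝ) < ((n + 1 : ℕ) : ℝ) :=
      (hjle n).trans_lt (mul_lt_of_lt_one_left (hpos n) ht1)
    exact_mod_cast this
  have hmem : ∀ n i : ℕ, i ≤ n + 1 → (i : ℝ) / ((n + 1 : ℕ) : ℝ) ∈ Icc (0 : ℝ) 1 := fun n i hi =>
    ⟨by positivity, (div_le_one (hpos n)).2 (by exact_mod_cast hi)⟩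
  have hzero : Filter.Tendsto (fun n : ℕ => 1 / ((n + 1 : ℕ) : ℝ)) Filter.atTop (nhds 0) := by
    simpa using tendsto_one_div_add_atTop_nhds_zero_nat (𝕜 := ℝ)
  have hlow : Filter.Tendsto (fun n => (j n : ℝ) / ((n + 1 : ℕ) : ℝ)) Filter.atTop (nhds t) := by
    refine tendsto_of_tendsto_of_tendsto_of_le_of_le
      (by simpa using (tendsto_const_nhds (x := t)).sub hzero) tendsto_const_nhds ?_ ?_
    · intro n
      have := hjlt n
      rw [le_div_iff₀ (hpos n), sub_mul, ← Nat.cast_add_one, inv_mul_cancel₀ (hpos n).ne']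
      linarith
    · intro n
      exact (div_le_iff₀ (hpos n)).2 (hjle n)
  have hupp : Filter.Tendsto (fun n => ((j n + 1 : ℕ) : ℝ) / ((n + 1 : ℕ) : ℝ)) Filter.atTop
      (nhds t) := by
    have := hlow.add hzero
    rw [add_zero] at this
    refine this.congr fun n => ?_
    rw [← add_div, Nat.cast_succ (j n)]
  refine tendsto_of_tendsto_of_tendsto_of_le_of_le
    (hcont.tendsto.comp (tendsto_nhdsWithin_iff.2 ⟨hlow, Filter.Eventually.of_forall fun n =>
      hmem n _ ((Nat.le_succ _).trans (hjN n))⟩))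
    (hcont.tendsto.comp (tendsto_nhdsWithin_iff.2 ⟨hupp, Filter.Eventually.of_forall fun n =>
      hmem n _ (hjN n)⟩)) ?_ ?_
  · intro n
    simp only [Function.comp]
    rw [← hingeInterp_grid hdist.2.1 n.succ_pos ((Nat.le_succ _).trans (hjN n))]
    exact monotone_hingeInterp hdist.1 hconv _ ((div_le_iff₀ (hpos n)).2 (hjle n))
  · intro n
    simp only [Function.comp]
    rw [← hingeInterp_grid hdist.2.1 n.succ_pos (hjN n)]
    refine monotone_hingeInterp hdist.1 hconv _ ((le_div_iff₀ (hpos n)).2 ?_)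
    exact_mod_cast (hjlt n).le

lemma integral_hingeInterp {S : ℝ → ℝ} (hS : Antitone S) (h : ℝ → ℝ) (N : ℕ) (b : ℝ) :
    ∫ x in (0 : ℝ)..b, hingeInterp h N (S x) = ∑ k ∈ Finset.range N,
      ((h ((k + 1 : ℕ) / N) - h ((k : ℕ) / N)) - (h ((k : ℕ) / N) - h ((k - 1 : ℕ) / N))) * N *
        ∫ x in (0 : ℝ)..b, max (S x - k / N) 0 := by
  simp only [hingeInterp]
  rw [intervalIntegral.integral_finsetSum fun k _ =>
    (intervalIntegrable_hinge hS _ 0 b).const_mul _]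
  simp only [intervalIntegral.integral_const_mul]

lemma tendsto_integral_hingeInterp_survival (P : Measure Ω) [IsProbabilityMeasure P] (Z : Ω → ℝ)
    {h : ℝ → ℝ} (hdist : IsDistortion h) (hconv : ConvexOn ℝ (Icc 0 1) h) (b : ℝ) :
    Filter.Tendsto (fun n : ℕ => ∫ x in (0 : ℝ)..b, hingeInterp h (n + 1) (survival P Z x))
      Filter.atTop (nhds (∫ x in (0 : ℝ)..b, h (survival P Z x))) := by
  refine intervalIntegral.tendsto_integral_filter_of_dominated_convergence (fun _ => (1 : ℝ))
    (Filter.Eventually.of_forall fun n => ?_) (Filter.Eventually.of_forall fun n => ?_)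
    intervalIntegrable_const ?_
  · exact (antitone_comp_survival P Z
      ((monotone_hingeInterp hdist.1 hconv _).monotoneOn _)).measurable.aestronglyMeasurable
  · refine Filter.Eventually.of_forall fun x _ => ?_
    have hm := monotone_hingeInterp hdist.1 hconv (n + 1)
    have hs := survival_mem_Icc P Z x
    have e0 := hingeInterp_grid hdist.2.1 n.succ_pos (Nat.zero_le (n + 1))
    have e1 := hingeInterp_grid hdist.2.1 n.succ_pos (le_refl (n + 1))
    rw [Nat.cast_zero, zero_div, hdist.2.1] at e0
    rw [div_self (by positivity), hdist.2.2] at e1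
    rw [Real.norm_eq_abs, abs_of_nonneg (e0 ▸ hm hs.1)]
    exact e1 ▸ hm hs.2
  · exact Filter.Eventually.of_forall fun x _ =>
      tendsto_hingeInterp hdist hconv (survival_mem_Icc P Z x)

lemma integral_distortion_survival_superadditive (P : Measure Ω) [IsProbabilityMeasure P]
    {h : ℝ → ℝ} (hdist : IsDistortion h) (hconv : ConvexOn ℝ (Icc 0 1) h)
    {U V W : Ω → ℝ} (hU : Measurable U) (hV : Measurable V) (hW : Measurable W)
    (hU0 : ∀ ω, 0 ≤ U ω) (hV0 : ∀ ω, 0 ≤ V ω) (hUVW : ∀ ω, U ω + V ω ≤ W ω)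
    {b : ℝ} (hb : 0 ≤ b) :
    (∫ x in (0 : ℝ)..b, h (survival P U x)) + (∫ x in (0 : ℝ)..b, h (survival P V x)) ≤
      ∫ x in (0 : ℝ)..(2 * b), h (survival P W x) := by
  refine le_of_tendsto_of_tendsto'
    ((tendsto_integral_hingeInterp_survival P U hdist hconv b).add
      (tendsto_integral_hingeInterp_survival P V hdist hconv b))
    (tendsto_integral_hingeInterp_survival P W hdist hconv (2 * b)) fun n => ?_
  simp only [integral_hingeInterp (antitone_survival P _)]
  rw [← Finset.sum_add_distrib]
  refine Finset.sum_le_sum fun k hk => ?_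
  rw [← mul_add]
  exact mul_le_mul_of_nonneg_left
    (integral_hinge_survival_superadditive P hU hV hW hU0 hV0 hUVW _ hb)
    (mul_nonneg (secondDiff_nonneg hdist.1 hconv (Finset.mem_range.1 hk)) (Nat.cast_nonneg _))

lemma distExp_eq_integral_sub (P : Measure Ω) [IsProbabilityMeasure P] {h : ℝ → ℝ}
    (hdist : IsDistortion h) {Z : Ω → ℝ} {L : ℝ} (hL : 0 ≤ L) (hZ : ∀ ω, |Z ω| ≤ L) :
    distExp P h Z =
      (∫ x in (0 : ℝ)..(2 * L), h (survival P (fun ω => Z ω + L) x)) - L := by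
  have hint : ∀ u v : ℝ, IntervalIntegrable (fun x => h (survival P Z x)) volume u v := fun u v =>
    (antitone_comp_survival P Z hdist.1).intervalIntegrable
  have hpos : ∫ x in Ioi (0 : ℝ), h (survival P Z x) = ∫ x in (0 : ℝ)..L, h (survival P Z x) := by
    rw [intervalIntegral.integral_of_le hL]
    refine (setIntegral_eq_of_subset_of_forall_sdiff_eq_zero measurableSet_Ioi
      Ioc_subset_Ioi_self fun x hx => ?_)
    have hLx : L < x := by
      by_contra! hle
      exact hx.2 ⟨hx.1, hle⟩
    have : {ω | Z ω > x} = ∅ := by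
      ext ω
      simpa using ((le_abs_self _).trans (hZ ω)).trans hLx.le
    simp [survival, this, hdist.2.1]
  have hneg : ∫ x in Iio (0 : ℝ), (h (survival P Z x) - 1) =
      ∫ x in (-L)..0, (h (survival P Z x) - 1) := by
    rw [intervalIntegral.integral_of_le (neg_nonpos.2 hL), integral_Ioc_eq_integral_Ioo,
      ← integral_Ico_eq_integral_Ioo]
    refine (setIntegral_eq_of_subset_of_forall_sdiff_eq_zero measurableSet_Iio
      Ico_subset_Iio_self fun x hx => ?_)
    have hLx : x < -L := by
      by_contra! hle
      exact hx.2 ⟨hle, hx.1⟩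
    have : {ω | Z ω > x} = univ := by
      ext ω
      simpa using hLx.trans_le (neg_le_of_abs_le (hZ ω))
    simp [survival, this, hdist.2.2]
  have hshift : ∫ x in (0 : ℝ)..(2 * L), h (survival P (fun ω => Z ω + L) x) =
      ∫ x in (-L)..L, h (survival P Z x) := by
    have : ∀ x, survival P (fun ω => Z ω + L) x = survival P Z (x - L) := fun x => by
      simp only [survival, gt_iff_lt, sub_lt_iff_lt_add]
    simp only [this]
    rw [intervalIntegral.integral_comp_sub_right (fun x => h (survival P Z x)) L]
    congr 1 <;> ring
  change (∫ x in Ioi (0 : ℝ), h (survival P Z x)) +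
    (∫ x in Iio (0 : ℝ), (h (survival P Z x) - 1)) = _
  rw [hpos, hneg, hshift, intervalIntegral.integral_sub (hint _ _) intervalIntegrable_const,
    ← intervalIntegral.integral_add_adjacent_intervals (hint (-L) 0) (hint 0 L)]
  simp
  ring

/-- Weak duality for convex distortions: if φ(x) + ψ(y) ≤ c(x,y) for all
x, y, then E^h[φ(X)] + E^h[ψ(Y)] ≤ E^h[c(X,Y)]. -/
theorem weak_duality_convex_distortion
    (P : Measure Ω) [IsProbabilityMeasure P] (hP : AtomlessProb P)
    (h : ℝ → ℝ) (hdist : IsDistortion h) (hconv : ConvexOn ℝ (Icc 0 1) h)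
    (c : ℝ → ℝ → ℝ) (hc : Measurable (fun q : ℝ × ℝ => c q.1 q.2))
    (φ ψ : ℝ → ℝ) (hφm : Measurable φ) (hφb : ∃ M : ℝ, ∀ x, |φ x| ≤ M)
    (hψm : Measurable ψ) (hψb : ∃ M : ℝ, ∀ x, |ψ x| ≤ M)
    (hle : ∀ x y : ℝ, φ x + ψ y ≤ c x y)
    (X Y : Ω → ℝ) (hX : IsBddRV X) (hY : IsBddRV Y)
    (hcb : ∃ M : ℝ, ∀ ω, |c (X ω) (Y ω)| ≤ M) :
    distExp P h (fun ω => φ (X ω)) + distExp P h (fun ω => ψ (Y ω)) ≤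
      distExp P h (fun ω => c (X ω) (Y ω)) := by
  obtain ⟨M₁, hM₁⟩ := hφb
  obtain ⟨M₂, hM₂⟩ := hψb
  obtain ⟨M₃, hM₃⟩ := hcb
  set M : ℝ := max |M₁| (max |M₂| |M₃|)
  have hM : 0 ≤ M := (abs_nonneg _).trans (le_max_left _ _)
  have hφM : ∀ ω, |φ (X ω)| ≤ M := fun ω =>
    (hM₁ _).trans ((le_abs_self _).trans (le_max_left _ _))
  have hψM : ∀ ω, |ψ (Y ω)| ≤ M := fun ω =>
    (hM₂ _).trans ((le_abs_self _).trans ((le_max_left _ _).trans (le_max_right _ _)))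
  have hcM : ∀ ω, |c (X ω) (Y ω)| ≤ 2 * M := fun ω =>
    ((hM₃ ω).trans ((le_abs_self _).trans ((le_max_right _ _).trans (le_max_right _ _)))).trans
      (by linarith)
  rw [distExp_eq_integral_sub P hdist hM hφM, distExp_eq_integral_sub P hdist hM hψM,
    distExp_eq_integral_sub P hdist (by linarith) hcM]
  have key := integral_distortion_survival_superadditive P hdist hconv
    (U := fun ω => φ (X ω) + M) (V := fun ω => ψ (Y ω) + M)
    (W := fun ω => c (X ω) (Y ω) + 2 * M) ((hφm.comp hX.1).add_const _)
    ((hψm.comp hY.1).add_const _) ((hc.comp (hX.1.prodMk hY.1)).add_const _)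
    (fun ω => by linarith [neg_le_of_abs_le (hφM ω)])
    (fun ω => by linarith [neg_le_of_abs_le (hψM ω)])
    (fun ω => by linarith [hle (X ω) (Y ω)]) (b := 2 * M) (by linarith)
  linarith
end
end

section
/- Necessary condition for universal optimality: Let h be a distortion function and suppose the copula C is universally optimal for h with linear cost. Then for all u,v∈[0,1] and all t with max(u+v−1,0) ≤ t ≤ min(u,v), one has h(1−C(u,v)) + h(1−u−v+C(u,v)) ≤ h(1−t) + h(1−u−v+t). -/
open MeasureTheory Set ProbabilityTheory

noncomputable section

variable {Ω : Type*} [MeasurableSpace Ω]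

namespace AtomlessProb

variable {P : Measure Ω}

lemma exists_subset_measureReal_le_half [IsProbabilityMeasure P] (hP : AtomlessProb P)
    {A : Set Ω} (hA : MeasurableSet A) (hpos : 0 < P.real A) :
    ∃ B ⊆ A, MeasurableSet B ∧ 0 < P.real B ∧ P.real B ≤ P.real A / 2 := by
  obtain ⟨B, hBA, hB, hB0, hBlt⟩ := hP A hA (ENNReal.toReal_pos_iff.1 hpos).1
  have h0 : 0 < P.real B := ENNReal.toReal_pos hB0.ne' (measure_ne_top P B)
  have h1 : P.real B < P.real A :=
    (ENNReal.toReal_lt_toReal (measure_ne_top P B) (measure_ne_top P A)).2 hBlt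
  have h2 : P.real (A \ B) = P.real A - P.real B := measureReal_sdiff hBA hB
  rcases le_total (P.real B) (P.real A / 2) with h | h
  · exact ⟨B, hBA, hB, h0, h⟩
  · exact ⟨A \ B, sdiff_subset, hA.diff hB, by linarith, by linarith⟩

lemma exists_subset_measureReal_lt [IsProbabilityMeasure P] (hP : AtomlessProb P)
    {A : Set Ω} (hA : MeasurableSet A) (hpos : 0 < P.real A) {ε : ℝ} (hε : 0 < ε) :
    ∃ B ⊆ A, MeasurableSet B ∧ 0 < P.real B ∧ P.real B < ε := by
  have key : ∀ n : ℕ, ∃ B ⊆ A, MeasurableSet B ∧ 0 < P.real B ∧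
      P.real B ≤ P.real A * (1 / 2) ^ n := by
    intro n
    induction n with
    | zero => exact ⟨A, Subset.rfl, hA, hpos, by simp⟩
    | succ n ih =>
      obtain ⟨B, hBA, hB, hB0, hBn⟩ := ih
      obtain ⟨D, hDB, hD, hD0, hDn⟩ := hP.exists_subset_measureReal_le_half hB hB0
      exact ⟨D, hDB.trans hBA, hD, hD0, by rw [pow_succ]; linarith⟩
  obtain ⟨n, hn⟩ := exists_pow_lt_of_lt_one hε (by norm_num : (1 / 2 : ℝ) < 1)
  obtain ⟨B, hBA, hB, hB0, hBn⟩ := key n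
  refine ⟨B, hBA, hB, hB0, hBn.trans_lt (lt_of_le_of_lt ?_ hn)⟩
  exact mul_le_of_le_one_left (by positivity) measureReal_le_one

/-- **Sierpiński's theorem**: an atomless probability measure takes all intermediate values. -/
theorem exists_subset_measureReal_eq [IsProbabilityMeasure P] (hP : AtomlessProb P)
    {A : Set Ω} (hA : MeasurableSet A) {c : ℝ} (hc0 : 0 ≤ c) (hcA : c ≤ P.real A) :
    ∃ B ⊆ A, MeasurableSet B ∧ P.real B = c := by
  let S := {B : Set Ω // B ⊆ A ∧ MeasurableSet B ∧ P.real B ≤ c}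
  have step : ∀ B : S, ∃ B' : S, B.1 ⊆ B'.1 ∧ ∀ D : S, B.1 ⊆ D.1 →
      P.real D.1 - P.real B.1 ≤ 2 * (P.real B'.1 - P.real B.1) := by
    intro B
    let V : Set ℝ := {r | ∃ D : S, B.1 ⊆ D.1 ∧ P.real D.1 = r}
    have hVb : BddAbove V := ⟨c, by rintro r ⟨D, -, rfl⟩; exact D.2.2.2⟩
    have hBV : P.real B.1 ∈ V := ⟨B, Subset.rfl, rfl⟩
    rcases (le_csSup hVb hBV).eq_or_lt with h | h
    · refine ⟨B, Subset.rfl, fun D hD => ?_⟩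
      have : P.real D.1 ≤ sSup V := le_csSup hVb ⟨D, hD, rfl⟩
      linarith
    · obtain ⟨r, ⟨B', hBB', rfl⟩, hr⟩ := exists_lt_of_lt_csSup ⟨_, hBV⟩
        (by linarith : (sSup V + P.real B.1) / 2 < sSup V)
      refine ⟨B', hBB', fun D hD => ?_⟩
      have : P.real D.1 ≤ sSup V := le_csSup hVb ⟨D, hD, rfl⟩
      linarith
  choose next hnext hgain using step
  let F : ℕ → S := fun n => next^[n] ⟨∅, empty_subset A, MeasurableSet.empty, by simpa using hc0⟩
  have hF : ∀ n, F (n + 1) = next (F n) := fun n => Function.iterate_succ_apply' next n _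
  have hmono : Monotone fun n => (F n).1 :=
    monotone_nat_of_le_succ fun n => by rw [hF]; exact hnext _
  let U : Set Ω := ⋃ n, (F n).1
  have hlim : Filter.Tendsto (fun n => P.real (F n).1) Filter.atTop (nhds (P.real U)) :=
    (ENNReal.tendsto_toReal (measure_ne_top P U)).comp (tendsto_measure_iUnion_atTop hmono)
  have hUA : U ⊆ A := iUnion_subset fun n => (F n).2.1
  have hU : MeasurableSet U := MeasurableSet.iUnion fun n => (F n).2.2.1
  have hUc : P.real U ≤ c := le_of_tendsto' hlim fun n => (F n).2.2.2
  refine ⟨U, hUA, hU, hUc.antisymm (not_lt.1 fun hlt => ?_)⟩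
  have hd : P.real (A \ U) = P.real A - P.real U := measureReal_sdiff hUA hU
  obtain ⟨D, hDA, hD, hD0, hDlt⟩ := hP.exists_subset_measureReal_lt (hA.diff hU)
    (by linarith) (sub_pos.2 hlt)
  have hUD : P.real (U ∪ D) = P.real U + P.real D :=
    measureReal_union (disjoint_sdiff_right.mono_right hDA) hD
  let E : S := ⟨U ∪ D, union_subset hUA (hDA.trans sdiff_subset), hU.union hD, by linarith⟩
  have hle : P.real E.1 - P.real U ≤ 2 * (P.real U - P.real U) := by
    refine le_of_tendsto_of_tendsto' (tendsto_const_nhds.sub hlim)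
      (((hlim.comp (Filter.tendsto_add_atTop_nat 1)).sub hlim).const_mul 2) fun n => ?_
    have := hgain (F n) E ((subset_iUnion (fun n => (F n).1) n).trans subset_union_left)
    rwa [← hF] at this
  have : P.real E.1 = P.real U + P.real D := hUD
  linarith

lemma exists_pair_measureReal_eq [IsProbabilityMeasure P] (hP : AtomlessProb P) {u v t : ℝ}
    (ht0 : 0 ≤ t) (htl : u + v - 1 ≤ t) (htu : t ≤ u) (htv : t ≤ v) (hu : u ≤ 1) :
    ∃ A B : Set Ω, MeasurableSet A ∧ MeasurableSet B ∧
      P.real A = u ∧ P.real B = v ∧ P.real (A ∩ B) = t := by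
  obtain ⟨A, -, hA, rfl⟩ := hP.exists_subset_measureReal_eq MeasurableSet.univ
    (ht0.trans htu) (by simpa using hu)
  obtain ⟨T, hTA, hT, rfl⟩ := hP.exists_subset_measureReal_eq hA ht0 htu
  obtain ⟨R, hRA, hR, hRv⟩ := hP.exists_subset_measureReal_eq hA.compl
    (sub_nonneg.2 htv) (by rw [probReal_compl_eq_one_sub hA]; linarith)
  have hAR : Disjoint A R := disjoint_compl_right.mono_right hRA
  refine ⟨A, T ∪ R, hA, hT.union hR, rfl, ?_, ?_⟩
  · rw [measureReal_union (hAR.mono_left hTA) hR, hRv]; ring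
  · rw [inter_union_distrib_left, hAR.inter_eq, union_empty, inter_eq_self_of_subset_right hTA]

end AtomlessProb

lemma IsCopula.frechet_bounds {C : ℝ → ℝ → ℝ} (hC : IsCopula C) {u v : ℝ}
    (hu : u ∈ Icc (0 : ℝ) 1) (hv : v ∈ Icc (0 : ℝ) 1) :
    0 ≤ C u v ∧ u + v - 1 ≤ C u v ∧ C u v ≤ u ∧ C u v ≤ v := by
  have h0 : (0 : ℝ) ∈ Icc (0 : ℝ) 1 := by simp
  have h1 : (1 : ℝ) ∈ Icc (0 : ℝ) 1 := by simp
  obtain ⟨hu0, -, hu1, -⟩ := hC.1 u hu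
  obtain ⟨-, hv0, -, hv1⟩ := hC.1 v hv
  have a := (hC.1 1 h1).1
  have b := (hC.1 1 h1).2.1
  have c := (hC.1 1 h1).2.2.1
  have d := (hC.1 0 h0).1
  have e₁ := hC.2 0 u 0 v h0 hu h0 hv hu.1 hv.1
  have e₂ := hC.2 u 1 v 1 hu h1 hv h1 hu.2 hv.2
  have e₃ := hC.2 0 u v 1 h0 hu hv h1 hu.1 hv.2
  have e₄ := hC.2 u 1 0 v hu h1 h0 hv hu.2 hv.1
  refine ⟨?_, ?_, ?_, ?_⟩ <;> linarith

section Indicator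

lemma indicator_compl_one_le_iff {α : Type*} (A : Set α) (x : ℝ) (ω : α) :
    Aᶜ.indicator (1 : α → ℝ) ω ≤ x ↔ (0 ≤ x ∧ ω ∈ A) ∨ 1 ≤ x := by
  by_cases h : ω ∈ A
  · simp only [indicator, mem_compl_iff, h, not_true_eq_false, if_false, and_true]
    exact ⟨Or.inl, fun h => h.elim id zero_le_one.trans⟩
  · simp [indicator, h]

lemma isBddRV_indicator_one {A : Set Ω} (hA : MeasurableSet A) :
    IsBddRV (A.indicator (1 : Ω → ℝ)) := by
  refine ⟨measurable_one.indicator hA, 1, fun ω => ?_⟩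
  by_cases h : ω ∈ A <;> simp [h]

variable {P : Measure Ω} [IsProbabilityMeasure P]

lemma identDistrib_indicator_one {A A' : Set Ω} (hA : MeasurableSet A) (hA' : MeasurableSet A')
    (h : P.real A = P.real A') :
    IdentDistrib (A.indicator (1 : Ω → ℝ)) (A'.indicator (1 : Ω → ℝ)) P P := by
  have hm := (measurable_one (α := ℝ)).indicator hA
  have hm' := (measurable_one (α := ℝ)).indicator hA'
  refine ⟨hm.aemeasurable, hm'.aemeasurable, Measure.ext fun s hs => ?_⟩
  have hAA' : P A = P A' := (measureReal_eq_measureReal_iff).1 h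
  have hcompl : P Aᶜ = P A'ᶜ := by rw [prob_compl_eq_one_sub hA, prob_compl_eq_one_sub hA', hAA']
  rw [Measure.map_apply hm hs, Measure.map_apply hm' hs]
  classical
  have hpre : ∀ B : Set Ω, B.indicator (1 : Ω → ℝ) ⁻¹' s =
      if (1 : ℝ) ∈ s then if (0 : ℝ) ∈ s then univ else B
      else if (0 : ℝ) ∈ s then Bᶜ else ∅ :=
    fun B => indicator_const_preimage_eq_union B s 1 ▸ by split_ifs <;> simp
  rw [hpre, hpre]
  split_ifs <;> simp [hAA', hcompl]

lemma hasCopula_indicator_compl {C : ℝ → ℝ → ℝ} (hC : IsCopula C) {A B : Set Ω}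
    (hAB : P.real (A ∩ B) = C (P.real A) (P.real B)) :
    HasCopula P (Aᶜ.indicator (1 : Ω → ℝ)) (Bᶜ.indicator (1 : Ω → ℝ)) C := by
  have hI : ∀ D : Set Ω, P.real D ∈ Icc (0 : ℝ) 1 :=
    fun D => ⟨measureReal_nonneg, measureReal_le_one⟩
  have hlaw : ∀ (D : Set Ω) (x : ℝ), {ω | Dᶜ.indicator (1 : Ω → ℝ) ω ≤ x} = ∅ ∨
      {ω | Dᶜ.indicator (1 : Ω → ℝ) ω ≤ x} = D ∨
      {ω | Dᶜ.indicator (1 : Ω → ℝ) ω ≤ x} = univ := by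
    intro D x
    simp only [indicator_compl_one_le_iff]
    by_cases h1 : 1 ≤ x
    · simp [h1]
    · by_cases h0 : 0 ≤ x <;> simp [h0, h1]
  intro x y
  change P.real ({ω | Aᶜ.indicator (1 : Ω → ℝ) ω ≤ x} ∩ {ω | Bᶜ.indicator (1 : Ω → ℝ) ω ≤ y}) =
    C (P.real _) (P.real _)
  rcases hlaw A x with h | h | h <;> rcases hlaw B y with h' | h' | h' <;> rw [h, h'] <;>
    simp [hAB, (hC.1 _ (hI A)).1, (hC.1 _ (hI A)).2.2.1, (hC.1 _ (hI B)).2.1,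
      (hC.1 _ (hI B)).2.2.2, (hC.1 0 (by simp)).1, (hC.1 1 (by simp)).1,
      (hC.1 1 (by simp)).2.1, (hC.1 1 (by simp)).2.2.1]

lemma distExp_indicator_compl_add {h : ℝ → ℝ} (hdist : IsDistortion h) {A B : Set Ω}
    (hA : MeasurableSet A) (hB : MeasurableSet B) :
    distExp P h (fun ω => Aᶜ.indicator (1 : Ω → ℝ) ω + Bᶜ.indicator (1 : Ω → ℝ) ω) =
      h (1 - P.real (A ∩ B)) + h (1 - P.real A - P.real B + P.real (A ∩ B)) := by
  have hgt : ∀ x, {ω | Aᶜ.indicator (1 : Ω → ℝ) ω + Bᶜ.indicator (1 : Ω → ℝ) ω > x} =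
      if x < 0 then univ else if x < 1 then (A ∩ B)ᶜ else if x < 2 then (A ∪ B)ᶜ else ∅ := by
    intro x
    ext ω
    by_cases ha : ω ∈ A <;> by_cases hb : ω ∈ B <;> split_ifs <;> simp [ha, hb] <;> linarith
  have hI : P.real (A ∩ B)ᶜ = 1 - P.real (A ∩ B) := probReal_compl_eq_one_sub (hA.inter hB)
  have hU : P.real (A ∪ B)ᶜ = 1 - P.real A - P.real B + P.real (A ∩ B) := by
    rw [probReal_compl_eq_one_sub (hA.union hB)]
    linarith [measureReal_union_add_inter (μ := P) (s := A) hB]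
  have hIio : ∫ x in Iio (0 : ℝ), (h (P.real {ω | Aᶜ.indicator (1 : Ω → ℝ) ω +
      Bᶜ.indicator (1 : Ω → ℝ) ω > x}) - 1) = 0 := by
    refine setIntegral_eq_zero_of_forall_eq_zero fun x hx => ?_
    rw [hgt, if_pos (mem_Iio.1 hx), probReal_univ, hdist.2.2, sub_self]
  have hIoi : ∀ x ∈ Ioi (0 : ℝ), h (P.real {ω | Aᶜ.indicator (1 : Ω → ℝ) ω +
      Bᶜ.indicator (1 : Ω → ℝ) ω > x}) =
      (Iio (1 : ℝ)).indicator (fun _ => h (P.real (A ∩ B)ᶜ)) x +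
        (Ico (1 : ℝ) 2).indicator (fun _ => h (P.real (A ∪ B)ᶜ)) x := by
    intro x hx
    rw [hgt, if_neg (not_lt.2 (mem_Ioi.1 hx).le)]
    by_cases h1 : x < 1
    · simp [h1]
    · by_cases h2 : x < 2 <;> simp [h1, h2, not_lt.1 h1, hdist.2.1]
  have hvol₁ : (volume.restrict (Ioi (0 : ℝ))) (Iio 1) = 1 := by
    rw [Measure.restrict_apply measurableSet_Iio, Iio_inter_Ioi, Real.volume_Ioo]
    simp
  have hvol₂ : (volume.restrict (Ioi (0 : ℝ))) (Ico 1 2) = 1 := by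
    rw [Measure.restrict_eq_self _ (Ico_subset_Ici_self.trans (Ici_subset_Ioi.2 zero_lt_one)),
      Real.volume_Ico]
    norm_num
  change (∫ x in Ioi (0 : ℝ), h (P.real _)) + (∫ x in Iio (0 : ℝ), (h (P.real _) - 1)) = _
  rw [hIio, add_zero, setIntegral_congr_fun measurableSet_Ioi hIoi, integral_add,
    integral_indicator_const _ measurableSet_Iio, integral_indicator_const _ measurableSet_Ico,
    measureReal_def (Measure.restrict _ _), measureReal_def (Measure.restrict _ _), hvol₁, hvol₂,
    hI, hU]
  · simp
  · exact (integrable_indicator_iff measurableSet_Iio).2 (integrableOn_const (by simp [hvol₁]))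
  · exact (integrable_indicator_iff measurableSet_Ico).2 (integrableOn_const (by simp [hvol₂]))

end Indicator

/-- If a copula C is universally optimal for h with linear cost, then
C(u,v) minimizes t ↦ h(1-t) + h(1-u-v+t) over the Fréchet interval
[max(u+v-1,0), min(u,v)]. -/
theorem univOptimal_necessary_condition
    (P : Measure Ω) [IsProbabilityMeasure P] (hP : AtomlessProb P)
    (h : ℝ → ℝ) (hdist : IsDistortion h)
    (C : ℝ → ℝ → ℝ) (hC : IsCopula C) (hopt : UnivOptimal P h C) :
    ∀ u ∈ Icc (0:ℝ) 1, ∀ v ∈ Icc (0:ℝ) 1, ∀ t : ℝ,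
      max (u + v - 1) 0 ≤ t → t ≤ min u v →
      h (1 - C u v) + h (1 - u - v + C u v) ≤ h (1 - t) + h (1 - u - v + t) := by
  intro u hu v hv t htl htu
  obtain ⟨hc0, hcl, hcu, hcv⟩ := hC.frechet_bounds hu hv
  rw [max_le_iff] at htl
  rw [le_min_iff] at htu
  obtain ⟨A, B, hA, hB, hAu, hBv, hAB⟩ :=
    hP.exists_pair_measureReal_eq hc0 hcl hcu hcv hu.2
  obtain ⟨A', B', hA', hB', hAu', hBv', hAB'⟩ :=
    hP.exists_pair_measureReal_eq htl.2 htl.1 htu.1 htu.2 hu.2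
  have key := hopt (Aᶜ.indicator 1) (Bᶜ.indicator 1) (A'ᶜ.indicator 1) (B'ᶜ.indicator 1)
    (isBddRV_indicator_one hA.compl) (isBddRV_indicator_one hB.compl)
    (isBddRV_indicator_one hA'.compl) (isBddRV_indicator_one hB'.compl)
    (hasCopula_indicator_compl hC (by rw [hAB, hAu, hBv]))
    (identDistrib_indicator_one hA.compl hA'.compl (by
      rw [probReal_compl_eq_one_sub hA, probReal_compl_eq_one_sub hA', hAu, hAu']))
    (identDistrib_indicator_one hB.compl hB'.compl (by
      rw [probReal_compl_eq_one_sub hB, probReal_compl_eq_one_sub hB', hBv, hBv']))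
  rwa [distExp_indicator_compl_add hdist hA hB, distExp_indicator_compl_add hdist hA' hB',
    hAu, hBv, hAB, hAu', hBv', hAB'] at key
end
end
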